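/- Let d ≥ 1, 1 < q < d+2, β ∈ (1, (d+2)/q], and let r satisfy r(β − 1) = qβ. Then there exists a constant N = N(d, q, β) such that for every R ∈ (0, ∞) and every u ∈ C_0^∞(ℝ^{d+1}) one has ‖Du‖_{E_{r, β−1}(C_R)} ≤ N ‖ |∂_t u| + |D²u| ‖_{E_{q, β}(C_R)} + N R^{-2} ‖u‖_{E_{q, β}(C_R)}. -/

import Mathlib

open MeasureTheory Set ENNReal Filter

noncomputable section

/-- Euclidean space `ℝ^d`. -/
abbrev Ed (d : ℕ) := EuclideanSpace ℝ (Fin d)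

/-- Points of `ℝ^{d+1}`: `z = (t, x)`. -/
abbrev Pt (d : ℕ) := ℝ × Ed d

/-- The parabolic cylinder `C_ρ(t,x)`. -/
def pCyl (d : ℕ) (ρ : ℝ) (z : Pt d) : Set (Pt d) :=
  {w | dist z.2 w.2 < ρ ∧ z.1 ≤ w.1 ∧ w.1 < z.1 + ρ ^ 2}

/-- The average `⨍_{C_ρ(z)} f`. -/
def pAvg (d : ℕ) (ρ : ℝ) (z : Pt d) (f : Pt d → ℝ≥0∞) : ℝ≥0∞ :=
  (volume (pCyl d ρ z))⁻¹ * ∫⁻ w in pCyl d ρ z, f w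

/-- The fractional maximal function `M_β f`. -/
def Mbeta (d : ℕ) (β : ℝ) (f : Pt d → ℝ≥0∞) (z : Pt d) : ℝ≥0∞ :=
  ⨆ (ρ : ℝ) (_ : 0 < ρ), ENNReal.ofReal (ρ ^ β) * pAvg d ρ z f

/-- The kernel `p_α(s, r)`. -/
def pKer (d : ℕ) (α : ℝ) (s r : ℝ) : ℝ≥0∞ :=
  if 0 < s then ENNReal.ofReal (s ^ (-(((d : ℝ) + 2 - α) / 2)) * Real.exp (-(r ^ 2) / s)) else 0

/-- The parabolic potential `P_α f`. -/
def Palpha (d : ℕ) (α : ℝ) (f : Pt d → ℝ≥0∞) (z : Pt d) : ℝ≥0∞ :=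
  ∫⁻ w : Pt d, pKer d α w.1 ‖w.2‖ * f (z.1 + w.1, z.2 + w.2)

/-- The parabolic Morrey norm `‖f‖_{E_{p,β}(Q)}`. -/
def MorreyNorm (d : ℕ) (p β : ℝ) (Q : Set (Pt d)) (f : Pt d → ℝ≥0∞) : ℝ≥0∞ :=
  ⨆ (ρ : ℝ) (_ : 0 < ρ) (z : Pt d) (_ : z ∈ Q),
    ENNReal.ofReal (ρ ^ β) * (pAvg d ρ z fun w => Q.indicator f w ^ p) ^ (1 / p)

/-- The `L_p`-norm on `ℝ^{d+1}`. -/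
def LpNormE (d : ℕ) (p : ℝ) (f : Pt d → ℝ≥0∞) : ℝ≥0∞ :=
  (∫⁻ z : Pt d, f z ^ p) ^ (1 / p)

/-- The mixed norm `‖f‖_{L_{q₁,q₂}}`. -/
def MixedNorm (d : ℕ) (q₁ q₂ : ℝ) (f : Pt d → ℝ≥0∞) : ℝ≥0∞ :=
  (∫⁻ t : ℝ, (∫⁻ x : Ed d, f (t, x) ^ q₁) ^ (q₂ / q₁)) ^ (1 / q₂)

/-- The normalized mixed norm `‖f‖_{L_{q₁,q₂}(Γ)}`. -/
def MixedNormOn (d : ℕ) (q₁ q₂ : ℝ) (Γ : Set (Pt d)) (f : Pt d → ℝ≥0∞) : ℝ≥0∞ :=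
  (MixedNorm d q₁ q₂ (Γ.indicator 1))⁻¹ * MixedNorm d q₁ q₂ (Γ.indicator f)

/-- The mixed-norm parabolic Morrey norm `‖f‖_{E_{q₁,q₂,β}(Q)}`. -/
def MixedMorrey (d : ℕ) (q₁ q₂ β : ℝ) (Q : Set (Pt d)) (f : Pt d → ℝ≥0∞) : ℝ≥0∞ :=
  ⨆ (ρ : ℝ) (_ : 0 < ρ) (z : Pt d) (_ : z ∈ Q),
    ENNReal.ofReal (ρ ^ β) * MixedNormOn d q₁ q₂ (pCyl d ρ z) (Q.indicator f)

/-- The symmetric parabolic maximal function `M̂ f`. -/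
def pMax (d : ℕ) (f : Pt d → ℝ≥0∞) (z : Pt d) : ℝ≥0∞ :=
  ⨆ (r : ℝ) (_ : 0 < r) (w : Pt d) (_ : z ∈ pCyl d r w), pAvg d r w f

/-- The time derivative `∂_t u`. -/
def timeDeriv (d : ℕ) (u : Pt d → ℝ) (z : Pt d) : ℝ :=
  fderiv ℝ u z ((1 : ℝ), (0 : Ed d))

/-- The spatial partial derivative `D_i u`. -/
def spDeriv (d : ℕ) (i : Fin d) (u : Pt d → ℝ) (z : Pt d) : ℝ :=
  fderiv ℝ u z ((0 : ℝ), EuclideanSpace.single i (1 : ℝ))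

/-- The Euclidean norm of the spatial gradient `|Du|`. -/
def gradNorm (d : ℕ) (u : Pt d → ℝ) (z : Pt d) : ℝ :=
  Real.sqrt (∑ i : Fin d, spDeriv d i u z ^ 2)

/-- The spatial Laplacian `Δu`. -/
def lap (d : ℕ) (u : Pt d → ℝ) (z : Pt d) : ℝ :=
  ∑ i : Fin d, spDeriv d i (spDeriv d i u) z

/-- The (Frobenius) norm of the spatial Hessian `|D²u|`. -/
def hessNorm (d : ℕ) (u : Pt d → ℝ) (z : Pt d) : ℝ :=
  Real.sqrt (∑ i : Fin d, ∑ j : Fin d, spDeriv d i (spDeriv d j u) z ^ 2)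


/-- Volume of the unit ball. -/
def ubV (d : ℕ) : ℝ≥0∞ := volume (Metric.ball (0 : Ed d) 1)

theorem ubV_ne_zero (d : ℕ) : ubV d ≠ 0 := (Metric.measure_ball_pos _ _ one_pos).ne'
theorem ubV_ne_top (d : ℕ) : ubV d ≠ ∞ := measure_ball_lt_top.ne

/-- Volume of the parabolic cylinder of radius `s`. -/
def cylV (d : ℕ) (s : ℝ) : ℝ≥0∞ := ENNReal.ofReal (s ^ (d + 2)) * ubV d

theorem cylV_ne_zero (d : ℕ) {s : ℝ} (hs : 0 < s) : cylV d s ≠ 0 := by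
  unfold cylV
  have : 0 < s ^ (d+2) := by positivity
  exact mul_ne_zero (by simpa using this) (ubV_ne_zero d)

theorem cylV_ne_top (d : ℕ) (s : ℝ) : cylV d s ≠ ∞ :=
  ENNReal.mul_ne_top ENNReal.ofReal_ne_top (ubV_ne_top d)

theorem cylV_mul (d : ℕ) {a s : ℝ} (ha : 0 ≤ a) :
    cylV d (a * s) = ENNReal.ofReal (a ^ (d + 2)) * cylV d s := by
  unfold cylV
  rw [mul_pow, ENNReal.ofReal_mul (by positivity), mul_assoc]

theorem vol_ball_Ed (d : ℕ) {s : ℝ} (hs : 0 < s) (x : Ed d) :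
    volume (Metric.ball x s) = ENNReal.ofReal (s ^ d) * ubV d := by
  have := Measure.addHaar_ball_of_pos (volume : Measure (Ed d)) x hs
  simpa [ubV] using this

theorem pCyl_eq (d : ℕ) (ρ : ℝ) (z : Pt d) :
    pCyl d ρ z = Ico z.1 (z.1 + ρ ^ 2) ×ˢ Metric.ball z.2 ρ := by
  ext w
  simp only [pCyl, mem_setOf_eq, mem_prod, mem_Ico, Metric.mem_ball, dist_comm w.2]
  tauto

theorem measurableSet_pCyl (d : ℕ) (ρ : ℝ) (z : Pt d) : MeasurableSet (pCyl d ρ z) := by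
  rw [pCyl_eq]
  exact measurableSet_Ico.prod Metric.isOpen_ball.measurableSet

theorem vol_pCyl (d : ℕ) {s : ℝ} (hs : 0 < s) (z : Pt d) : volume (pCyl d s z) = cylV d s := by
  rw [pCyl_eq, Measure.volume_eq_prod, Measure.prod_prod, vol_ball_Ed d hs, Real.volume_Ico, cylV,
    ← mul_assoc, ← ENNReal.ofReal_mul (by ring_nf; positivity)]
  congr 2
  ring

/-- Symmetric parabolic box. -/
def pBox (d : ℕ) (s : ℝ) (z : Pt d) : Set (Pt d) := Metric.ball z.1 (s ^ 2) ×ˢ Metric.ball z.2 s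

theorem isOpen_pBox (d : ℕ) (s : ℝ) (z : Pt d) : IsOpen (pBox d s z) :=
  Metric.isOpen_ball.prod Metric.isOpen_ball

theorem vol_pBox (d : ℕ) {s : ℝ} (hs : 0 < s) (z : Pt d) :
    volume (pBox d s z) = 2 * cylV d s := by
  rw [pBox, Measure.volume_eq_prod, Measure.prod_prod, vol_ball_Ed d hs, Real.volume_ball, cylV,
    ← mul_assoc, ← mul_assoc, ENNReal.ofReal_mul (by norm_num), ENNReal.ofReal_ofNat, mul_assoc 2,
    ← ENNReal.ofReal_mul (by positivity)]
  congr 3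
  ring

theorem mem_pBox_self (d : ℕ) {s : ℝ} (hs : 0 < s) (z : Pt d) : z ∈ pBox d s z :=
  ⟨Metric.mem_ball_self (by positivity), Metric.mem_ball_self hs⟩

theorem pBox_engulf (d : ℕ) {a b : ℝ} (ha : 0 < a) (hb : 0 < b) (hab : a ≤ 2 * b) (z w : Pt d)
    (h : (pBox d a z ∩ pBox d b w).Nonempty) : z ∈ pBox d (3 * b) w := by
  obtain ⟨y, hy1, hy2⟩ := h
  simp only [pBox, mem_prod, Metric.mem_ball] at *
  obtain ⟨h1, h2⟩ := hy1
  obtain ⟨h3, h4⟩ := hy2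
  constructor
  · have := dist_triangle_left z.1 w.1 y.1
    have h5 : a ^ 2 ≤ 4 * b ^ 2 := by nlinarith
    nlinarith
  · have := dist_triangle_left z.2 w.2 y.2
    linarith

/-- One-scale average over a symmetric box. -/
def boxAvg (d : ℕ) (s : ℝ) (g : Pt d → ℝ≥0∞) (z : Pt d) : ℝ≥0∞ :=
  (2 * cylV d s)⁻¹ * ∫⁻ w in pBox d s z, g w

/-- Centered dyadic-scale maximal function. -/
def cMax (d : ℕ) (S : ℝ) (g : Pt d → ℝ≥0∞) (z : Pt d) : ℝ≥0∞ :=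
  ⨆ k : ℕ, boxAvg d (S / 2 ^ k) g z

theorem measurable_boxAvg (d : ℕ) (s : ℝ) {g : Pt d → ℝ≥0∞} (hg : Measurable g) :
    Measurable (boxAvg d s g) := by
  unfold boxAvg
  apply Measurable.const_mul
  have : ∀ z : Pt d, ∫⁻ w in pBox d s z, g w =
      ∫⁻ w, ({p : Pt d × Pt d | p.2 ∈ pBox d s p.1}).indicator (fun p => g p.2) (z, w) := by
    intro z
    rw [← lintegral_indicator (isOpen_pBox d s z).measurableSet]
    rfl
  simp_rw [this]
  apply Measurable.lintegral_prod_right'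
  apply (hg.comp measurable_snd).indicator
  apply IsOpen.measurableSet
  have : {p : Pt d × Pt d | p.2 ∈ pBox d s p.1} =
    {p : Pt d × Pt d | dist p.2.1 p.1.1 < s ^ 2} ∩ {p | dist p.2.2 p.1.2 < s} := by
    ext p; simp [pBox]
  rw [this]
  exact (isOpen_lt (by fun_prop) (by fun_prop)).inter (isOpen_lt (by fun_prop) (by fun_prop))

theorem measurable_cMax (d : ℕ) (S : ℝ) {g : Pt d → ℝ≥0∞} (hg : Measurable g) :
    Measurable (cMax d S g) :=
  Measurable.iSup fun k => measurable_boxAvg d _ hg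

theorem boxAvg_le_const (d : ℕ) {s : ℝ} (hs : 0 < s) {g : Pt d → ℝ≥0∞} {c : ℝ≥0∞}
    (hg : ∀ z, g z ≤ c) (z : Pt d) : boxAvg d s g z ≤ c := by
  unfold boxAvg
  calc (2 * cylV d s)⁻¹ * ∫⁻ w in pBox d s z, g w
      ≤ (2 * cylV d s)⁻¹ * ∫⁻ w in pBox d s z, c := by gcongr; exact hg _
    _ = (2 * cylV d s)⁻¹ * (2 * cylV d s) * c := by
        rw [setLIntegral_const, vol_pBox d hs]; ring
    _ = c := by
        rw [ENNReal.inv_mul_cancel, one_mul]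
        · exact mul_ne_zero (by norm_num) (cylV_ne_zero d hs)
        · exact ENNReal.mul_ne_top (by norm_num) (cylV_ne_top d s)

theorem cMax_le_const (d : ℕ) {S : ℝ} (hS : 0 < S) {g : Pt d → ℝ≥0∞} {c : ℝ≥0∞}
    (hg : ∀ z, g z ≤ c) (z : Pt d) : cMax d S g z ≤ c :=
  iSup_le fun k => boxAvg_le_const d (by positivity) hg z

theorem cMax_add_le (d : ℕ) (S : ℝ) {g h : Pt d → ℝ≥0∞} (hg : Measurable g) (z : Pt d) :
    cMax d S (fun w => g w + h w) z ≤ cMax d S g z + cMax d S h z := by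
  refine iSup_le fun k => ?_
  calc boxAvg d (S / 2 ^ k) (fun w => g w + h w) z
      = boxAvg d (S / 2 ^ k) g z + boxAvg d (S / 2 ^ k) h z := by
        unfold boxAvg
        rw [lintegral_add_left hg, mul_add]
    _ ≤ _ := by
        gcongr
        · exact le_iSup (fun k => boxAvg d (S / 2 ^ k) g z) k
        · exact le_iSup (fun k => boxAvg d (S / 2 ^ k) h z) k

theorem cMax_weak (d : ℕ) {S : ℝ} (hS : 0 < S) (g : Pt d → ℝ≥0∞) (l : ℝ≥0∞)
    (hl0 : l ≠ 0) (hlt : l ≠ ∞) :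
    volume {z | l < cMax d S g z} ≤ ENNReal.ofReal (3 ^ (d + 2)) * l⁻¹ * ∫⁻ w, g w := by
  let t : Set (Pt d × ℕ) := {p | l < boxAvg d (S / 2 ^ p.2) g p.1}
  let B : Pt d × ℕ → Set (Pt d) := fun p => pBox d (S / 2 ^ p.2) p.1
  let δ : Pt d × ℕ → ℝ := fun p => S / 2 ^ p.2
  have hδ : ∀ p, 0 < δ p := fun p => by simp only [δ]; positivity
  obtain ⟨u, hut, hud, hucov⟩ := Vitali.exists_disjoint_subfamily_covering_enlargement B t δ 2
    (by norm_num) (fun a _ => (hδ a).le) S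
    (fun a _ => div_le_self hS.le (one_le_pow₀ (by norm_num)))
    (fun a _ => ⟨a.1, mem_pBox_self d (hδ a) a.1⟩)
  have hcount : u.Countable := hud.countable_of_isOpen (fun a _ => isOpen_pBox d _ _)
    (fun a _ => ⟨a.1, mem_pBox_self d (hδ a) a.1⟩)
  have hsub : {z | l < cMax d S g z} ⊆ ⋃ p ∈ u, pBox d (3 * δ p) p.1 := by
    intro z hz
    simp only [mem_setOf_eq, cMax, lt_iSup_iff] at hz
    obtain ⟨k, hk⟩ := hz
    obtain ⟨b, hb, hne, hle⟩ := hucov (z, k) hk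
    exact mem_biUnion hb (pBox_engulf d (hδ (z, k)) (hδ b) hle z b.1 hne)
  have hterm : ∀ p ∈ u, volume (pBox d (3 * δ p) p.1) ≤
      ENNReal.ofReal (3 ^ (d + 2)) * l⁻¹ * ∫⁻ w in B p, g w := by
    intro p hp
    have h1 : l < (2 * cylV d (δ p))⁻¹ * ∫⁻ w in B p, g w := hut hp
    have h2 : 2 * cylV d (δ p) * l ≤ ∫⁻ w in B p, g w := by
      rw [mul_comm, ← ENNReal.le_div_iff_mul_le, ENNReal.div_eq_inv_mul]
      · exact h1.le
      · left; exact mul_ne_zero (by norm_num) (cylV_ne_zero d (hδ p))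
      · left; exact ENNReal.mul_ne_top (by norm_num) (cylV_ne_top d _)
    rw [vol_pBox d (by have := hδ p; positivity), cylV_mul d (by norm_num), mul_assoc]
    calc 2 * (ENNReal.ofReal (3 ^ (d + 2)) * cylV d (δ p))
        = ENNReal.ofReal (3 ^ (d + 2)) * (l⁻¹ * (2 * cylV d (δ p) * l)) := by
          rw [mul_comm l⁻¹, mul_assoc (2 * cylV d (δ p)), ENNReal.mul_inv_cancel hl0 hlt]; ring
      _ ≤ _ := by gcongr
  calc volume {z | l < cMax d S g z} ≤ volume (⋃ p ∈ u, pBox d (3 * δ p) p.1) := measure_mono hsub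
    _ ≤ ∑' p : u, volume (pBox d (3 * δ p) p.1.1) := measure_biUnion_le _ hcount _
    _ ≤ ∑' p : u, ENNReal.ofReal (3 ^ (d + 2)) * l⁻¹ * ∫⁻ w in B p, g w :=
        ENNReal.tsum_le_tsum fun p => hterm p p.2
    _ = ENNReal.ofReal (3 ^ (d + 2)) * l⁻¹ * ∫⁻ w in ⋃ p ∈ u, B p, g w := by
        rw [ENNReal.tsum_mul_left,
          lintegral_biUnion hcount (fun p _ => (isOpen_pBox d _ _).measurableSet) hud]
    _ ≤ _ := by gcongr; exact Measure.restrict_le_self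

theorem weak_split (d : ℕ) {S : ℝ} (hS : 0 < S) {g : Pt d → ℝ≥0∞} (hg : Measurable g) (l : ℝ)
    (hl : 0 < l) :
    volume {z | ENNReal.ofReal l < cMax d S g z} ≤
      ENNReal.ofReal (3 ^ (d + 2)) * ENNReal.ofReal (2 / l) *
        ∫⁻ w, {w | ENNReal.ofReal (l / 2) < g w}.indicator g w := by
  let A := {w | ENNReal.ofReal (l / 2) < g w}
  have hA : MeasurableSet A := measurableSet_lt measurable_const hg
  have hsub : {z | ENNReal.ofReal l < cMax d S g z} ⊆
      {z | ENNReal.ofReal (l / 2) < cMax d S (A.indicator g) z} := by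
    intro z hz
    simp only [mem_setOf_eq] at *
    by_contra hcon
    push Not at hcon
    have h1 : cMax d S g z ≤ cMax d S (A.indicator g) z + cMax d S (Aᶜ.indicator g) z := by
      refine le_trans (le_of_eq ?_) (cMax_add_le d S (hg.indicator hA) z)
      congr 1
      ext w
      exact (congrFun (indicator_self_add_compl A g) w).symm
    have h2 : cMax d S (Aᶜ.indicator g) z ≤ ENNReal.ofReal (l / 2) := by
      apply cMax_le_const d hS
      intro w
      apply indicator_le'
      · intro w hw
        simpa [A] using hw
      · intro w hw; exact zero_le
    have h3 := hz.trans_le (h1.trans (add_le_add hcon h2))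
    rw [← ENNReal.ofReal_add (by positivity) (by positivity), add_halves] at h3
    exact lt_irrefl _ h3
  refine (measure_mono hsub).trans ((cMax_weak d hS _ _ ?_ ENNReal.ofReal_ne_top).trans (le_of_eq ?_))
  · simp [hl]
  · rw [← ENNReal.ofReal_inv_of_pos (by positivity), inv_div]

theorem cMax_strong (d : ℕ) {S : ℝ} (hS : 0 < S) {q : ℝ} (hq : 1 < q) {g : Pt d → ℝ≥0∞}
    (hg : Measurable g) {c : ℝ≥0∞} (hc : c ≠ ∞) (hgc : ∀ z, g z ≤ c) :
    ∫⁻ z, cMax d S g z ^ q ≤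
      ENNReal.ofReal (q * (3 ^ (d + 2) * 2 * (2 ^ (q - 1) / (q - 1)))) * ∫⁻ z, g z ^ q := by
  have hfin : ∀ z, cMax d S g z ≠ ∞ := fun z => ne_top_of_le_ne_top hc (cMax_le_const d hS hgc z)
  have hgfin : ∀ z, g z ≠ ∞ := fun z => ne_top_of_le_ne_top hc (hgc z)
  have h1 : ∫⁻ z, cMax d S g z ^ q =
      ENNReal.ofReal q * ∫⁻ t in Ioi (0:ℝ), volume {a | t < (cMax d S g a).toReal} *
        ENNReal.ofReal (t ^ (q - 1)) := by
    rw [← lintegral_rpow_eq_lintegral_meas_lt_mul volume (Eventually.of_forall fun z => by simp)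
      (measurable_cMax d S hg).ennreal_toReal.aemeasurable (by linarith)]
    apply lintegral_congr
    intro z
    rw [← ENNReal.ofReal_rpow_of_nonneg (by simp) (by linarith), ENNReal.ofReal_toReal (hfin z)]
  have h2 : ∀ t ∈ Ioi (0:ℝ), volume {a | t < (cMax d S g a).toReal} * ENNReal.ofReal (t ^ (q - 1))
      ≤ ENNReal.ofReal (3 ^ (d + 2) * 2) * ∫⁻ w, ENNReal.ofReal (t ^ (q - 2)) *
        {w | ENNReal.ofReal (t / 2) < g w}.indicator g w := by
    intro t ht
    have ht : 0 < t := ht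
    have e : {a | t < (cMax d S g a).toReal} = {z | ENNReal.ofReal t < cMax d S g z} := by
      ext z
      simp only [mem_setOf_eq]
      rw [ENNReal.ofReal_lt_iff_lt_toReal ht.le (hfin z)]
    have hA : Measurable ({w | ENNReal.ofReal (t / 2) < g w}.indicator g) :=
      hg.indicator (measurableSet_lt measurable_const hg)
    rw [e, lintegral_const_mul _ hA]
    calc _ ≤ (ENNReal.ofReal (3 ^ (d + 2)) * ENNReal.ofReal (2 / t) *
        ∫⁻ w, {w | ENNReal.ofReal (t / 2) < g w}.indicator g w) * ENNReal.ofReal (t ^ (q - 1)) := by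
          gcongr; exact weak_split d hS hg t ht
      _ = ENNReal.ofReal (3 ^ (d + 2) * (2 / t) * t ^ (q - 1)) *
          ∫⁻ w, {w | ENNReal.ofReal (t / 2) < g w}.indicator g w := by
          rw [ENNReal.ofReal_mul (by positivity), ENNReal.ofReal_mul (by positivity)]; ring
      _ = _ := by
          rw [← mul_assoc, ← ENNReal.ofReal_mul (by positivity)]
          congr 2
          rw [show q - 1 = (q - 2) + 1 by ring, Real.rpow_add_one ht.ne']
          field_simp
  have h3 : ∀ w, ∫⁻ t in Ioi (0:ℝ), ENNReal.ofReal (t ^ (q - 2)) *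
        {w | ENNReal.ofReal (t / 2) < g w}.indicator g w =
        ENNReal.ofReal (2 ^ (q - 1) / (q - 1)) * g w ^ q := by
    intro w
    obtain ⟨a, ha⟩ : ∃ a : ℝ, a = (g w).toReal := ⟨_, rfl⟩
    have ha0 : 0 ≤ a := by rw [ha]; simp
    have hga : g w = ENNReal.ofReal a := by rw [ha, ENNReal.ofReal_toReal (hgfin w)]
    have e : ∀ t ∈ Ioi (0:ℝ), ENNReal.ofReal (t ^ (q - 2)) *
        {w | ENNReal.ofReal (t / 2) < g w}.indicator g w =
        (Ioo 0 (2 * a)).indicator (fun t => ENNReal.ofReal (t ^ (q - 2)) * ENNReal.ofReal a) t := by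
      intro t ht
      have ht : 0 < t := ht
      by_cases h : t < 2 * a
      · rw [indicator_of_mem, indicator_of_mem, hga]
        · exact ⟨ht, h⟩
        · simp only [mem_setOf_eq, hga]
          rw [ENNReal.ofReal_lt_ofReal_iff_of_nonneg (by positivity)]; linarith
      · rw [indicator_of_notMem, indicator_of_notMem, mul_zero]
        · intro h'; exact h h'.2
        · simp only [mem_setOf_eq, hga]
          rw [ENNReal.ofReal_lt_ofReal_iff_of_nonneg (by positivity)]; linarith
    rw [setLIntegral_congr_fun measurableSet_Ioi e, setLIntegral_indicator measurableSet_Ioo,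
      inter_eq_left.2 Ioo_subset_Ioi_self, lintegral_mul_const' _ _ ENNReal.ofReal_ne_top]
    have hintg : IntegrableOn (fun t : ℝ => t ^ (q - 2)) (Ioo 0 (2 * a)) := by
      have := (intervalIntegral.intervalIntegrable_rpow' (a := 0) (b := 2 * a) (r := q - 2)
        (by linarith))
      rw [intervalIntegrable_iff_integrableOn_Ioo_of_le (by positivity)] at this
      exact this
    rw [← ofReal_integral_eq_lintegral_ofReal hintg
      ((ae_restrict_iff' measurableSet_Ioo).2 (Eventually.of_forall fun t ht =>
        Real.rpow_nonneg ht.1.le _)),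
      ← integral_Ioc_eq_integral_Ioo, ← intervalIntegral.integral_of_le (by positivity),
      integral_rpow (Or.inl (by linarith)), hga, ENNReal.ofReal_rpow_of_nonneg ha0 (by linarith),
      ← ENNReal.ofReal_mul' ha0, ← ENNReal.ofReal_mul (div_nonneg (by positivity) (by linarith))]
    congr 1
    rw [show q - 2 + 1 = q - 1 by ring, Real.zero_rpow (by linarith), sub_zero,
      Real.mul_rpow (by norm_num) ha0]
    rcases ha0.eq_or_lt with h | h
    · rw [← h, Real.zero_rpow (by linarith), Real.zero_rpow (by linarith)]; simp
    · rw [show q = (q - 1) + 1 by ring, Real.rpow_add_one h.ne']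
      simp only [add_sub_cancel_right]
      ring
  rw [h1, ENNReal.ofReal_mul (by linarith), mul_assoc]
  gcongr
  calc _ ≤ ∫⁻ t in Ioi (0:ℝ), ENNReal.ofReal (3 ^ (d + 2) * 2) *
        ∫⁻ w, ENNReal.ofReal (t ^ (q - 2)) * {w | ENNReal.ofReal (t / 2) < g w}.indicator g w :=
        setLIntegral_mono' measurableSet_Ioi h2
    _ = ENNReal.ofReal (3 ^ (d + 2) * 2) * ∫⁻ w, ∫⁻ t in Ioi (0:ℝ), ENNReal.ofReal (t ^ (q - 2)) *
        {w | ENNReal.ofReal (t / 2) < g w}.indicator g w := by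
        rw [lintegral_const_mul' _ _ ENNReal.ofReal_ne_top, lintegral_lintegral_swap]
        apply Measurable.aemeasurable
        apply Measurable.mul
        · exact ((measurable_fst).pow_const _).ennreal_ofReal
        · have : (Function.uncurry fun (t : ℝ) (w : Pt d) =>
            {w | ENNReal.ofReal (t / 2) < g w}.indicator g w) =
            {p : ℝ × Pt d | ENNReal.ofReal (p.1 / 2) < g p.2}.indicator (fun p => g p.2) := by
            ext p; rfl
          change Measurable (Function.uncurry fun (t : ℝ) (w : Pt d) =>
            {w | ENNReal.ofReal (t / 2) < g w}.indicator g w)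
          rw [this]
          apply (hg.comp measurable_snd).indicator
          exact measurableSet_lt ((measurable_fst.div_const _).ennreal_ofReal)
            (hg.comp measurable_snd)
    _ = ENNReal.ofReal (3 ^ (d + 2) * 2) * ∫⁻ w, ENNReal.ofReal (2 ^ (q - 1) / (q - 1)) * g w ^ q := by
        simp_rw [h3]
    _ = _ := by
        rw [lintegral_const_mul' _ _ ENNReal.ofReal_ne_top, ← mul_assoc,
          ← ENNReal.ofReal_mul (by positivity)]

theorem holder_avg {α : Type*} [MeasurableSpace α] {μ : Measure α} {q : ℝ} (hq : 1 < q)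
    {A : Set α} (h0 : μ A ≠ 0) (ht : μ A ≠ ∞) {g : α → ℝ≥0∞} (hg : Measurable g) :
    (μ A)⁻¹ * ∫⁻ w in A, g w ∂μ ≤ ((μ A)⁻¹ * ∫⁻ w in A, g w ^ q ∂μ) ^ (1 / q) := by
  have hpq : q.HolderConjugate (q / (q - 1)) := Real.HolderConjugate.conjExponent hq
  have h := ENNReal.lintegral_mul_le_Lp_mul_Lq (μ.restrict A) hpq (f := g) (g := fun _ => 1)
    hg.aemeasurable aemeasurable_const
  simp only [Pi.mul_apply, mul_one, ENNReal.one_rpow, lintegral_const, one_mul,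
    Measure.restrict_apply_univ] at h
  rw [ENNReal.mul_rpow_of_nonneg _ _ (by positivity)]
  calc (μ A)⁻¹ * ∫⁻ w in A, g w ∂μ
      ≤ (μ A)⁻¹ * ((∫⁻ w in A, g w ^ q ∂μ) ^ (1 / q) * μ A ^ (1 / (q / (q - 1)))) := by gcongr
    _ = ((μ A)⁻¹ * μ A ^ (1 / (q / (q - 1)))) * (∫⁻ w in A, g w ^ q ∂μ) ^ (1 / q) := by ring
    _ = _ := by
        congr 1
        rw [← ENNReal.rpow_neg_one, ← ENNReal.rpow_mul, ← ENNReal.rpow_add _ _ h0 ht]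
        congr 1
        have : q ≠ 0 := by positivity
        field_simp
        ring

/-- The homothety of the unit cylinder into `C_R`, with centre `z`. -/
def Tm (d : ℕ) (R ε : ℝ) (z w : Pt d) : Pt d :=
  (z.1 + ε ^ 2 * (R ^ 2 * w.1 - z.1), z.2 + ε • (R • w.2 - z.2))

theorem map_scale (d : ℕ) {b : ℝ} (hb : 0 < b) (c : Pt d) :
    Measure.map (fun w : Pt d => (c.1 + b ^ 2 * w.1, c.2 + b • w.2)) volume =
      (ENNReal.ofReal (b ^ (d + 2)))⁻¹ • (volume : Measure (Pt d)) := by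
  have h1 : Measure.map (fun s : ℝ => c.1 + b ^ 2 * s) volume =
      (ENNReal.ofReal (b ^ 2))⁻¹ • (volume : Measure ℝ) := by
    have : (fun s : ℝ => c.1 + b ^ 2 * s) = (fun s => c.1 + s) ∘ (fun s => b ^ 2 • s) := by
      ext s; simp
    rw [this, ← Measure.map_map (by fun_prop) (by fun_prop),
      Measure.map_addHaar_smul _ (by positivity), Measure.map_smul, map_add_left_eq_self]
    congr 1
    rw [← ENNReal.ofReal_inv_of_pos (by positivity), abs_of_pos (by positivity)]
    simp
  have h2 : Measure.map (fun s : Ed d => c.2 + b • s) volume =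
      (ENNReal.ofReal (b ^ d))⁻¹ • (volume : Measure (Ed d)) := by
    have : (fun s : Ed d => c.2 + b • s) = (fun s => c.2 + s) ∘ (fun s => b • s) := by
      ext s; simp
    rw [this, ← Measure.map_map (by fun_prop) (by fun_prop),
      Measure.map_addHaar_smul _ (by positivity), Measure.map_smul, map_add_left_eq_self]
    congr 1
    rw [← ENNReal.ofReal_inv_of_pos (by positivity), abs_of_pos (by positivity)]
    simp
  have h3 := Measure.map_prod_map (volume : Measure ℝ) (volume : Measure (Ed d))
    (f := fun s : ℝ => c.1 + b ^ 2 * s) (g := fun s : Ed d => c.2 + b • s)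
    (by fun_prop) (by fun_prop)
  have h4 : (fun w : Pt d => (c.1 + b ^ 2 * w.1, c.2 + b • w.2)) =
      Prod.map (fun s : ℝ => c.1 + b ^ 2 * s) (fun s : Ed d => c.2 + b • s) := rfl
  rw [h4, Measure.volume_eq_prod, ← h3, h1, h2]
  rw [Measure.prod_smul_left, Measure.prod_smul_right, smul_smul]
  congr 1
  rw [← ENNReal.mul_inv (by left; simp; positivity) (by left; simp),
    ← ENNReal.ofReal_mul (by positivity)]
  congr 2
  ring

/-- Average of `h` on the small cylinder of scale `εR` near `z`. -/
def Fp (d : ℕ) (R : ℝ) (h : Pt d → ℝ≥0∞) (ε : ℝ) (z : Pt d) : ℝ≥0∞ :=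
  ∫⁻ w in pCyl d 1 0, h (Tm d R ε z w)

theorem Fp_le_set (d : ℕ) {R ε : ℝ} (hR : 0 < R) (hε : 0 < ε) {h : Pt d → ℝ≥0∞}
    (hh : Measurable h) (z : Pt d) {A : Set (Pt d)} (hA : MeasurableSet A)
    (hT : ∀ w ∈ pCyl d 1 0, Tm d R ε z w ∈ A) :
    Fp d R h ε z ≤ (ENNReal.ofReal ((ε * R) ^ (d + 2)))⁻¹ * ∫⁻ w in A, h w := by
  have e : (Tm d R ε z) = (fun w : Pt d => (((z.1 - ε ^ 2 * z.1, z.2 - ε • z.2) : Pt d).1 +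
      (ε * R) ^ 2 * w.1, ((z.1 - ε ^ 2 * z.1, z.2 - ε • z.2) : Pt d).2 + (ε * R) • w.2)) := by
    funext w
    simp only [Tm]
    refine Prod.ext ?_ ?_
    · simp only; ring
    · simp only; module
  have hm : Measurable (Tm d R ε z) := by unfold Tm; fun_prop
  calc Fp d R h ε z ≤ ∫⁻ w in pCyl d 1 0, A.indicator h (Tm d R ε z w) := by
        apply setLIntegral_mono' (measurableSet_pCyl d 1 0)
        intro w hw
        rw [indicator_of_mem (hT w hw)]
    _ ≤ ∫⁻ w, A.indicator h (Tm d R ε z w) := setLIntegral_le_lintegral _ _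
    _ = ∫⁻ y, A.indicator h y ∂(Measure.map (Tm d R ε z) volume) := by
        rw [lintegral_map (hh.indicator hA) hm]
    _ = _ := by
        have := map_scale d (mul_pos hε hR) ((z.1 - ε ^ 2 * z.1, z.2 - ε • z.2) : Pt d)
        have e2 : Measure.map (Tm d R ε z) volume =
          (ENNReal.ofReal ((ε * R) ^ (d + 2)))⁻¹ • (volume : Measure (Pt d)) := by
          rw [← this, e]
        rw [e2, lintegral_smul_measure, lintegral_indicator hA, smul_eq_mul]

theorem Tm_time (d : ℕ) {R ε : ℝ} (hε : 0 < ε) (z w : Pt d) (hw : w ∈ pCyl d 1 0) (hR : 0 < R) :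
    z.1 - ε ^ 2 * z.1 ≤ (Tm d R ε z w).1 ∧ (Tm d R ε z w).1 < z.1 - ε ^ 2 * z.1 + (ε * R) ^ 2 := by
  obtain ⟨_, h2, h3⟩ := hw
  simp only [Prod.fst_zero, one_pow, zero_add] at h2 h3
  have : 0 < (ε * R) ^ 2 := by positivity
  simp only [Tm]
  constructor <;> nlinarith

theorem Tm_space (d : ℕ) {R ε : ℝ} (hε : 0 < ε) (z w : Pt d) (hw : w ∈ pCyl d 1 0) (hR : 0 < R)
    (hz : z ∈ pCyl d R 0) : dist (Tm d R ε z w).2 z.2 < 2 * (ε * R) := by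
  have h1 := hw.1
  have h2 := hz.1
  simp only [Prod.snd_zero, dist_zero_left] at h1 h2
  simp only [Tm, dist_eq_norm, add_sub_cancel_left, norm_smul, Real.norm_eq_abs, abs_of_pos hε]
  have := norm_sub_le (R • w.2) z.2
  rw [norm_smul, Real.norm_eq_abs, abs_of_pos hR] at this
  nlinarith [mul_lt_mul_of_pos_left h1 hR]

theorem Tm_mem (d : ℕ) {R ε : ℝ} (hε : 0 < ε) (hε1 : ε ≤ 1) (z w : Pt d) (hw : w ∈ pCyl d 1 0)
    (hR : 0 < R) (hz : z ∈ pCyl d R 0) : Tm d R ε z w ∈ pCyl d R 0 := by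
  obtain ⟨h1, h2, h3⟩ := hw
  obtain ⟨g1, g2, g3⟩ := hz
  simp only [Prod.snd_zero, dist_zero_left, Prod.fst_zero, one_pow, zero_add] at *
  have hε2 : ε ^ 2 ≤ 1 := by nlinarith
  have hε3 : 0 < ε ^ 2 := by positivity
  have e : z.2 + ε • (R • w.2 - z.2) = (1 - ε) • z.2 + (ε * R) • w.2 := by module
  refine ⟨?_, ?_, ?_⟩
  · simp only [Tm, Prod.snd_zero, dist_zero_left, e]
    have := norm_add_le ((1 - ε) • z.2) ((ε * R) • w.2)
    rw [norm_smul, norm_smul, Real.norm_eq_abs, Real.norm_eq_abs, abs_of_nonneg (by linarith),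
      abs_of_pos (by positivity)] at this
    nlinarith [mul_lt_mul_of_pos_left h1 (mul_pos hε hR),
      mul_le_mul_of_nonneg_left g1.le (sub_nonneg.2 hε1)]
  · simp only [Tm, Prod.fst_zero]
    nlinarith [mul_nonneg (mul_nonneg hε3.le (sq_nonneg R)) h2, mul_nonneg (sub_nonneg.2 hε2) g2]
  · simp only [Tm, Prod.fst_zero, zero_add]
    have hR2 : 0 < R ^ 2 := by positivity
    nlinarith [mul_lt_mul_of_pos_left h3 (mul_pos hε3 hR2),
      mul_le_mul_of_nonneg_left g3.le (sub_nonneg.2 hε2)]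

theorem base_mem (d : ℕ) {R ε : ℝ} (hε : 0 < ε) (hε1 : ε ≤ 1) (z : Pt d)
    (hz : z ∈ pCyl d R 0) : (z.1 - ε ^ 2 * z.1, z.2) ∈ pCyl d R 0 := by
  obtain ⟨g1, g2, g3⟩ := hz
  simp only [Prod.fst_zero, zero_add] at *
  have hε2 : ε ^ 2 ≤ 1 := by nlinarith
  refine ⟨g1, ?_, ?_⟩
  · simp only [Prod.fst_zero]; nlinarith
  · simp only [Prod.fst_zero, zero_add]; nlinarith [mul_nonneg (sq_nonneg ε) g2]

theorem morrey_avg (d : ℕ) (p β : ℝ) (Q : Set (Pt d)) (f : Pt d → ℝ≥0∞) {ρ : ℝ} (hρ : 0 < ρ)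
    {z : Pt d} (hz : z ∈ Q) :
    (pAvg d ρ z fun w => Q.indicator f w ^ p) ^ (1 / p) ≤
      ENNReal.ofReal (ρ ^ (-β)) * MorreyNorm d p β Q f := by
  have h : ENNReal.ofReal (ρ ^ β) * (pAvg d ρ z fun w => Q.indicator f w ^ p) ^ (1 / p) ≤
      MorreyNorm d p β Q f := by
    unfold MorreyNorm
    exact le_iSup₂_of_le ρ hρ (le_iSup₂_of_le z hz le_rfl)
  calc _ = ENNReal.ofReal (ρ ^ (-β)) * (ENNReal.ofReal (ρ ^ β) *
        (pAvg d ρ z fun w => Q.indicator f w ^ p) ^ (1 / p)) := by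
        rw [← mul_assoc, ← ENNReal.ofReal_mul (by positivity), ← Real.rpow_add hρ]
        simp
    _ ≤ _ := by gcongr

theorem Fp_le_morrey (d : ℕ) {q β : ℝ} (hq : 1 < q) (hβ : 0 < β) {R ε : ℝ} (hR : 0 < R) (hε : 0 < ε)
    (hε1 : ε ≤ 1) {h : Pt d → ℝ≥0∞} (hh : Measurable h) {z : Pt d} (hz : z ∈ pCyl d R 0) :
    Fp d R h ε z ≤ (ENNReal.ofReal (2 ^ (d + 2)) * ubV d * MorreyNorm d q β (pCyl d R 0) h) *
      ENNReal.ofReal ((ε * R) ^ (-β)) := by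
  set b := ε * R with hb
  have hb0 : 0 < b := mul_pos hε hR
  set z' : Pt d := (z.1 - ε ^ 2 * z.1, z.2)
  have hz' := base_mem d hε hε1 z hz
  set Q := pCyl d R 0 with hQ
  have hQm : MeasurableSet Q := measurableSet_pCyl d R 0
  have hT : ∀ w ∈ pCyl d 1 0, Tm d R ε z w ∈ pCyl d (2 * b) z' ∩ Q := by
    intro w hw
    refine ⟨⟨?_, ?_, ?_⟩, Tm_mem d hε hε1 z w hw hR hz⟩
    · rw [dist_comm]; exact Tm_space d hε z w hw hR hz
    · exact (Tm_time d hε z w hw hR).1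
    · refine (Tm_time d hε z w hw hR).2.trans ?_
      simp only [z']; nlinarith
  have h1 := Fp_le_set d hR hε hh z ((measurableSet_pCyl d (2 * b) z').inter hQm) hT
  have h2 := holder_avg (μ := volume) hq (A := pCyl d (2 * b) z')
    (by rw [vol_pCyl d (by positivity)]; exact cylV_ne_zero d (by positivity))
    (by rw [vol_pCyl d (by positivity)]; exact cylV_ne_top d _) (hh.indicator hQm)
  have h3 := h2.trans (morrey_avg d q β Q h (ρ := 2 * b) (by positivity) hz')
  rw [vol_pCyl d (by positivity), setLIntegral_indicator hQm, inter_comm Q] at h3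
  have hc0 : cylV d (2 * b) ≠ 0 := cylV_ne_zero d (by positivity)
  have hct : cylV d (2 * b) ≠ ∞ := cylV_ne_top d _
  have hbn : ENNReal.ofReal (b ^ (d + 2)) ≠ 0 := by simp; positivity
  calc Fp d R h ε z ≤ (ENNReal.ofReal (b ^ (d + 2)))⁻¹ * ∫⁻ w in pCyl d (2 * b) z' ∩ Q, h w := h1
    _ = (ENNReal.ofReal (b ^ (d + 2)))⁻¹ * (cylV d (2 * b) * ((cylV d (2 * b))⁻¹ *
        ∫⁻ w in pCyl d (2 * b) z' ∩ Q, h w)) := by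
        rw [← mul_assoc (cylV d (2 * b)), ENNReal.mul_inv_cancel hc0 hct, one_mul]
    _ ≤ (ENNReal.ofReal (b ^ (d + 2)))⁻¹ * (cylV d (2 * b) * (ENNReal.ofReal ((2 * b) ^ (-β)) *
        MorreyNorm d q β Q h)) := by gcongr
    _ ≤ (ENNReal.ofReal (b ^ (d + 2)))⁻¹ * (cylV d (2 * b) * (ENNReal.ofReal (b ^ (-β)) *
        MorreyNorm d q β Q h)) := by
        have hmono : (2 * b) ^ (-β) ≤ b ^ (-β) :=
          Real.rpow_le_rpow_of_nonpos hb0 (by linarith) (by linarith)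
        have hmono' := ENNReal.ofReal_le_ofReal hmono
        exact mul_le_mul_right (mul_le_mul_right (mul_le_mul_left hmono' _) _) _
    _ = ((ENNReal.ofReal (b ^ (d + 2)))⁻¹ * ENNReal.ofReal (b ^ (d + 2))) * (ENNReal.ofReal (2 ^ (d + 2)) * ubV d * MorreyNorm d q β Q h) *
        ENNReal.ofReal (b ^ (-β)) := by
        rw [cylV_mul d (by norm_num), cylV]; ring
    _ = _ := by rw [ENNReal.inv_mul_cancel hbn ENNReal.ofReal_ne_top, one_mul]

theorem Fp_le_cMax (d : ℕ) {R ε ρ : ℝ} (hR : 0 < R) (hε : 0 < ε)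
    (hε1 : ε ≤ 1) (hρ : 0 < ρ) (hερ : ε * R ≤ ρ) {h : Pt d → ℝ≥0∞} (hh : Measurable h)
    {z z0 : Pt d} (hz : z ∈ pCyl d R 0) (hz0 : z ∈ pCyl d ρ z0) :
    Fp d R h ε z ≤ (2 * ENNReal.ofReal (4 ^ (d + 2)) * ubV d) * cMax d (2 * ρ)
      ((pCyl d (3 * ρ) (max 0 (z0.1 - ρ ^ 2), z0.2) ∩ pCyl d R 0).indicator h) z := by
  set b := ε * R with hb
  have hb0 : 0 < b := mul_pos hε hR
  set z1 : Pt d := (max 0 (z0.1 - ρ ^ 2), z0.2)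
  set A := pCyl d (3 * ρ) z1 ∩ pCyl d R 0
  have hA : MeasurableSet A := (measurableSet_pCyl _ _ _).inter (measurableSet_pCyl _ _ _)
  obtain ⟨n, hn1, hn2⟩ := exists_nat_pow_near (x := ρ / b) (y := (2:ℝ))
    ((one_le_div hb0).2 hερ) (by norm_num)
  set s := 2 * ρ / 2 ^ n with hs
  have h2n : (0:ℝ) < 2 ^ n := by positivity
  have hs1 : 2 * b ≤ s := by
    rw [hs, le_div_iff₀ h2n]
    rw [le_div_iff₀ hb0] at hn1
    linarith
  have hs2 : s ≤ 4 * b := by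
    rw [hs, div_le_iff₀ h2n]
    rw [div_lt_iff₀ hb0, pow_succ] at hn2
    linarith
  have hs0 : 0 < s := by linarith
  have hzt : 0 ≤ z.1 ∧ z.1 < R ^ 2 := by
    have := hz.2; simpa using this
  have hT : ∀ w ∈ pCyl d 1 0, Tm d R ε z w ∈ pBox d s z ∩ A := by
    intro w hw
    have k1 := Tm_time d hε z w hw hR
    have k2 := Tm_space d hε z w hw hR hz
    have k3 := Tm_mem d hε hε1 z w hw hR hz
    have k4 : ε ^ 2 * z.1 ≤ b ^ 2 := by
      rw [hb, mul_pow]; exact mul_le_mul_of_nonneg_left hzt.2.le (sq_nonneg ε)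
    have k5 : b ^ 2 ≤ ρ ^ 2 := by gcongr
    have k6 : 0 ≤ ε ^ 2 * z.1 := mul_nonneg (sq_nonneg _) hzt.1
    have k7 : 0 < b ^ 2 := by positivity
    refine ⟨⟨?_, ?_⟩, ⟨?_, ?_, ?_⟩, k3⟩
    · rw [Metric.mem_ball, Real.dist_eq, abs_lt]
      have : (2 * b) ^ 2 ≤ s ^ 2 := by gcongr
      constructor <;> nlinarith
    · rw [Metric.mem_ball]; exact k2.trans_le hs1
    · have := dist_triangle z1.2 z.2 (Tm d R ε z w).2
      have k := hz0.1
      rw [dist_comm z.2] at this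
      simp only [z1] at *
      linarith
    · simp only [z1]
      apply max_le
      · simpa using k3.2.1
      · have := hz0.2.1; linarith
    · have := hz0.2.2
      have k8 : z0.1 - ρ ^ 2 ≤ z1.1 := le_max_right _ _
      nlinarith
  have h1 := Fp_le_set d hR hε hh z ((isOpen_pBox d s z).measurableSet.inter hA) hT
  have hc0 : 2 * cylV d s ≠ 0 := mul_ne_zero (by norm_num) (cylV_ne_zero d (by positivity))
  have hct : 2 * cylV d s ≠ ∞ := ENNReal.mul_ne_top (by norm_num) (cylV_ne_top d _)
  have hbn : ENNReal.ofReal (b ^ (d + 2)) ≠ 0 := by simp; positivity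
  calc Fp d R h ε z ≤ (ENNReal.ofReal (b ^ (d + 2)))⁻¹ * ∫⁻ w in pBox d s z ∩ A, h w := h1
    _ = (ENNReal.ofReal (b ^ (d + 2)))⁻¹ * (2 * cylV d s * boxAvg d s (A.indicator h) z) := by
        rw [boxAvg, ← mul_assoc (2 * cylV d s), ENNReal.mul_inv_cancel hc0 hct, one_mul,
          setLIntegral_indicator hA, inter_comm]
    _ ≤ (ENNReal.ofReal (b ^ (d + 2)))⁻¹ * (2 * cylV d (4 * b) *
          cMax d (2 * ρ) (A.indicator h) z) := by
        gcongr
        · unfold cylV; gcongr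
        · exact le_iSup (fun k : ℕ => boxAvg d (2 * ρ / 2 ^ k) (A.indicator h) z) n
    _ = ((ENNReal.ofReal (b ^ (d + 2)))⁻¹ * ENNReal.ofReal (b ^ (d + 2))) *
        (2 * ENNReal.ofReal (4 ^ (d + 2)) * ubV d * cMax d (2 * ρ) (A.indicator h) z) := by
        rw [cylV_mul d (by norm_num), cylV]; ring
    _ = _ := by rw [ENNReal.inv_mul_cancel hbn ENNReal.ofReal_ne_top, one_mul]

theorem lintegral_tail {β R s : ℝ} (hβ : 1 < β) (hR : 0 < R) (hs : 0 < s) :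
    ENNReal.ofReal R * ∫⁻ ε in Ioi (s / R), ENNReal.ofReal ((ε * R) ^ (-β)) =
      ENNReal.ofReal (s ^ (1 - β) / (β - 1)) := by
  have hsR : 0 < s / R := by positivity
  have e : ∀ ε ∈ Ioi (s / R), ENNReal.ofReal ((ε * R) ^ (-β)) =
      ENNReal.ofReal (R ^ (-β)) * ENNReal.ofReal (ε ^ (-β)) := by
    intro ε hε
    have : 0 < ε := hsR.trans hε
    rw [Real.mul_rpow this.le hR.le, ENNReal.ofReal_mul (by positivity), mul_comm]
  rw [setLIntegral_congr_fun measurableSet_Ioi e, lintegral_const_mul' _ _ ENNReal.ofReal_ne_top,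
    ← ofReal_integral_eq_lintegral_ofReal (integrableOn_Ioi_rpow_of_lt (by linarith) hsR)
      ((ae_restrict_iff' measurableSet_Ioi).2 (Eventually.of_forall fun t ht =>
        Real.rpow_nonneg (hsR.trans ht).le _)), integral_Ioi_rpow_of_lt (by linarith) hsR,
    ← ENNReal.ofReal_mul (by positivity), ← ENNReal.ofReal_mul (by positivity)]
  congr 1
  rw [Real.div_rpow hs.le hR.le, Real.rpow_add hR, Real.rpow_add hs, Real.rpow_sub hs,
    Real.rpow_neg hs.le, Real.rpow_neg hR.le, Real.rpow_one, Real.rpow_one]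
  have : R ^ β ≠ 0 := by positivity
  have : s ^ β ≠ 0 := by positivity
  have : β - 1 ≠ 0 := by linarith
  have : -β + 1 ≠ 0 := by linarith
  field_simp
  ring

theorem hedberg_base {β R ρ s : ℝ} (hβ : 1 < β) (hR : 0 < R) (hs : 0 < s) (hsρ : s ≤ ρ)
    {A B : ℝ≥0∞} {F : ℝ → ℝ≥0∞}
    (hA : ∀ ε ∈ Ioo (0:ℝ) 1, F ε ≤ A * ENNReal.ofReal ((ε * R) ^ (-β)))
    (hB : ∀ ε ∈ Ioo (0:ℝ) 1, ε * R ≤ ρ → F ε ≤ B) :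
    ENNReal.ofReal R * ∫⁻ ε in Ioo (0:ℝ) 1, F ε ≤
      ENNReal.ofReal s * B + A * ENNReal.ofReal (s ^ (1 - β) / (β - 1)) := by
  have hsR : 0 < s / R := by positivity
  have hmeas : Measurable fun ε : ℝ => ENNReal.ofReal ((ε * R) ^ (-β)) := by fun_prop
  have h1 : ∫⁻ ε in Ioo (0:ℝ) 1, F ε ≤ ∫⁻ ε, ((Ioc 0 (s / R)).indicator (fun _ => B) ε +
      (Ioi (s / R)).indicator (fun ε => A * ENNReal.ofReal ((ε * R) ^ (-β))) ε) := by
    rw [← lintegral_indicator measurableSet_Ioo]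
    apply lintegral_mono
    intro ε
    by_cases h : ε ∈ Ioo (0:ℝ) 1
    · rw [indicator_of_mem h]
      by_cases h' : ε ≤ s / R
      · refine (hB ε h ?_).trans ?_
        · rw [le_div_iff₀ hR] at h'; linarith
        · simp only
          rw [indicator_of_mem (show ε ∈ Ioc 0 (s / R) from ⟨h.1, h'⟩)]
          exact le_self_add
      · refine (hA ε h).trans ?_
        simp only
        rw [indicator_of_mem (show ε ∈ Ioi (s / R) from not_le.1 h')]
        exact le_add_self
    · rw [indicator_of_notMem h]; exact zero_le
  calc _ ≤ ENNReal.ofReal R * (ENNReal.ofReal (s / R) * B + A * ∫⁻ ε in Ioi (s / R), ENNReal.ofReal ((ε * R) ^ (-β))) := by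
        gcongr
        refine h1.trans (le_of_eq ?_)
        rw [lintegral_add_left (measurable_const.indicator measurableSet_Ioc),
          lintegral_indicator measurableSet_Ioc, lintegral_indicator measurableSet_Ioi,
          setLIntegral_const, lintegral_const_mul _ hmeas, Real.volume_Ioc, sub_zero, mul_comm B]
    _ = (ENNReal.ofReal R * ENNReal.ofReal (s / R)) * B + A * (ENNReal.ofReal R * ∫⁻ ε in Ioi (s / R), ENNReal.ofReal ((ε * R) ^ (-β))) := by ring
    _ = _ := by
        rw [lintegral_tail hβ hR hs, ← ENNReal.ofReal_mul hR.le, mul_div_cancel₀ _ hR.ne']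

theorem hedberg {β R ρ : ℝ} (hβ : 1 < β) (hR : 0 < R) (hρ : 0 < ρ)
    {A B : ℝ≥0∞} {F : ℝ → ℝ≥0∞}
    (hA : ∀ ε ∈ Ioo (0:ℝ) 1, F ε ≤ A * ENNReal.ofReal ((ε * R) ^ (-β)))
    (hB : ∀ ε ∈ Ioo (0:ℝ) 1, ε * R ≤ ρ → F ε ≤ B) :
    ENNReal.ofReal R * ∫⁻ ε in Ioo (0:ℝ) 1, F ε ≤ ENNReal.ofReal (1 + 1 / (β - 1)) *
      (A ^ (1 / β) * B ^ (1 - 1 / β) + A * ENNReal.ofReal (ρ ^ (1 - β))) := by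
  have hβ0 : 0 < β := by linarith
  have hβ1 : 0 < β - 1 := by linarith
  have hβi : 1 / β < 1 := by rw [div_lt_one hβ0]; exact hβ
  have hρp : 0 < ρ ^ (1 - β) := by positivity
  have hc : 0 < 1 + 1 / (β - 1) := by positivity
  have hc1 : ENNReal.ofReal (1 + 1 / (β - 1)) ≠ 0 := by simpa using hc
  rcases eq_or_ne A 0 with hA0 | hA0
  · have : ∫⁻ ε in Ioo (0:ℝ) 1, F ε = 0 := by
      rw [setLIntegral_congr_fun (g := fun _ => 0) measurableSet_Ioo, lintegral_zero]
      intro ε hε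
      have := hA ε hε
      simpa [hA0] using this
    rw [this, mul_zero]; exact zero_le
  rcases eq_or_ne A ∞ with hAt | hAt
  · have : A * ENNReal.ofReal (ρ ^ (1 - β)) = ∞ := by
      rw [hAt, ENNReal.top_mul]; simpa using hρp
    rw [this, add_top, ENNReal.mul_top hc1]; exact le_top
  rcases eq_or_ne B ∞ with hBt | hBt
  · have : A ^ (1 / β) * B ^ (1 - 1 / β) = ∞ := by
      rw [hBt, ENNReal.top_rpow_of_pos (by linarith), ENNReal.mul_top]
      simp [hA0, hAt]
    rw [this, top_add, ENNReal.mul_top hc1]; exact le_top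
  lift A to NNReal using hAt
  lift B to NNReal using hBt
  obtain ⟨a, ha⟩ : ∃ a : ℝ, a = A := ⟨_, rfl⟩
  obtain ⟨b, hb⟩ : ∃ b : ℝ, b = B := ⟨_, rfl⟩
  have ea : (A : ℝ≥0∞) = ENNReal.ofReal a := by rw [ha, ENNReal.ofReal_coe_nnreal]
  have eb : (B : ℝ≥0∞) = ENNReal.ofReal b := by rw [hb, ENNReal.ofReal_coe_nnreal]
  have ha0 : 0 < a := by
    rw [ha]; exact_mod_cast pos_iff_ne_zero.2 (by simpa using hA0)
  have hb0 : 0 ≤ b := by rw [hb]; exact B.2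
  have key : ∀ s, 0 < s → s ≤ ρ → s * b + a * (s ^ (1 - β) / (β - 1)) ≤ (1 + 1 / (β - 1)) *
      (a ^ (1 / β) * b ^ (1 - 1 / β) + a * ρ ^ (1 - β)) →
      ENNReal.ofReal R * ∫⁻ ε in Ioo (0:ℝ) 1, F ε ≤ ENNReal.ofReal (1 + 1 / (β - 1)) *
      ((A:ℝ≥0∞) ^ (1 / β) * B ^ (1 - 1 / β) + A * ENNReal.ofReal (ρ ^ (1 - β))) := by
    intro s hs hsρ h
    refine (hedberg_base hβ hR hs hsρ hA hB).trans ?_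
    rw [ea, eb, ENNReal.ofReal_rpow_of_nonneg ha0.le (by positivity),
      ENNReal.ofReal_rpow_of_nonneg hb0 (by linarith), ← ENNReal.ofReal_mul (by positivity),
      ← ENNReal.ofReal_mul (by positivity), ← ENNReal.ofReal_mul (by positivity),
      ← ENNReal.ofReal_mul (by positivity),
      ← ENNReal.ofReal_add (by positivity) (by positivity),
      ← ENNReal.ofReal_add (by positivity) (by positivity), ← ENNReal.ofReal_mul (by positivity)]
    exact ENNReal.ofReal_le_ofReal h
  rcases hb0.eq_or_lt with hbz | hbp
  · apply key ρ hρ le_rfl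
    rw [← hbz, Real.zero_rpow (by linarith)]
    have : 0 < a * ρ ^ (1 - β) := by positivity
    have e : a * (ρ ^ (1 - β) / (β - 1)) = 1 / (β - 1) * (a * ρ ^ (1 - β)) := by ring
    rw [e]
    simp only [mul_zero, zero_add]
    nlinarith
  set s0 := (a / b) ^ (1 / β) with hs0
  have hs0p : 0 < s0 := by positivity
  have e1 : s0 * b = a ^ (1 / β) * b ^ (1 - 1 / β) := by
    rw [hs0, Real.div_rpow ha0.le hb0, Real.rpow_sub hbp, Real.rpow_one]
    have : b ^ (1 / β) ≠ 0 := by positivity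
    field_simp
  have e2 : a * s0 ^ (1 - β) = a ^ (1 / β) * b ^ (1 - 1 / β) := by
    have : s0 ^ β = a / b := by
      rw [hs0, ← Real.rpow_mul (by positivity), one_div_mul_cancel hβ0.ne', Real.rpow_one]
    rw [Real.rpow_sub hs0p, this, Real.rpow_one, ← e1]
    field_simp
  set X := a ^ (1 / β) * b ^ (1 - 1 / β)
  have hX : 0 < X := by positivity
  have hY : 0 < a * ρ ^ (1 - β) := by positivity
  have hi : 0 < 1 / (β - 1) := by positivity
  by_cases h : s0 ≤ ρ
  · apply key s0 hs0p h
    have e : a * (s0 ^ (1 - β) / (β - 1)) = 1 / (β - 1) * (a * s0 ^ (1 - β)) := by ring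
    rw [e, e1, e2]
    nlinarith [mul_pos hi hY]
  · apply key ρ hρ le_rfl
    have e : a * (ρ ^ (1 - β) / (β - 1)) = 1 / (β - 1) * (a * ρ ^ (1 - β)) := by ring
    rw [e]
    have : ρ * b ≤ X := by
      rw [← e1]; gcongr; exact (not_le.1 h).le
    nlinarith [mul_pos hi hX]

theorem bump_exists (d : ℕ) : ∃ (ψ : Ed d → ℝ) (C : ℝ), 0 < C ∧ ContDiff ℝ 1 ψ ∧
    HasCompactSupport ψ ∧ tsupport ψ ⊆ Metric.ball 0 1 ∧ ∫ x, ψ x = 1 ∧ (∀ x, |ψ x| ≤ C) ∧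
    (∀ x, ‖fderiv ℝ ψ x‖ ≤ C) := by
  let φ : ContDiffBump (0 : Ed d) := ⟨1/4, 1/2, by norm_num, by norm_num⟩
  have h1 : ContDiff ℝ 1 (φ.normed volume) := φ.contDiff_normed (n := 1)
  have h2 := φ.hasCompactSupport_normed (μ := volume)
  obtain ⟨C1, hC1⟩ := h2.exists_bound_of_continuous h1.continuous
  obtain ⟨C2, hC2⟩ := (h2.fderiv ℝ).exists_bound_of_continuous (h1.continuous_fderiv (by simp))
  refine ⟨φ.normed volume, max (max C1 C2) 1, by positivity, h1, h2, ?_, φ.integral_normed, ?_, ?_⟩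
  · rw [φ.tsupport_normed_eq]
    exact Metric.closedBall_subset_ball (by norm_num [φ])
  · intro x; exact (hC1 x).trans ((le_max_left _ _).trans (le_max_left _ _))
  · intro x; exact (hC2 x).trans ((le_max_right _ _).trans (le_max_left _ _))

theorem ibp (d : ℕ) {ψ G : Ed d → ℝ} (hψ : ContDiff ℝ 1 ψ) (hs : HasCompactSupport ψ)
    (hG : ContDiff ℝ 1 G) (e : Ed d) :
    ∫ x, ψ x * fderiv ℝ G x e = - ∫ x, fderiv ℝ ψ x e * G x := by
  have c1 : Continuous fun x => fderiv ℝ ψ x e := by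
    have := hψ.continuous_fderiv (by simp); fun_prop
  have c2 : Continuous fun x => fderiv ℝ G x e := by
    have := hG.continuous_fderiv (by simp); fun_prop
  have s1 : HasCompactSupport fun x => fderiv ℝ ψ x e := hs.fderiv_apply ℝ e
  apply integral_mul_fderiv_eq_neg_fderiv_mul_of_integrable
  · exact (c1.mul hG.continuous).integrable_of_hasCompactSupport s1.mul_right
  · exact (hψ.continuous.mul c2).integrable_of_hasCompactSupport hs.mul_right
  · exact (hψ.continuous.mul hG.continuous).integrable_of_hasCompactSupport hs.mul_right
  · intro x _; exact hψ.differentiable (by simp) x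
  · intro x _; exact hG.differentiable (by simp) x

theorem contDiff_dirDeriv {E : Type*} [NormedAddCommGroup E] [NormedSpace ℝ E] {u : E → ℝ}
    (hu : ContDiff ℝ (⊤ : ℕ∞) u) (e : E) : ContDiff ℝ (⊤ : ℕ∞) (fun z => fderiv ℝ u z e) := by
  have : ContDiff ℝ (⊤ : ℕ∞) (fderiv ℝ u) := hu.fderiv_right (by simp)
  exact this.clm_apply contDiff_const

theorem contDiff_spDeriv (d : ℕ) {u : Pt d → ℝ} (hu : ContDiff ℝ (⊤ : ℕ∞) u) (i : Fin d) :
    ContDiff ℝ (⊤ : ℕ∞) (spDeriv d i u) := contDiff_dirDeriv hu _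

theorem contDiff_timeDeriv (d : ℕ) {u : Pt d → ℝ} (hu : ContDiff ℝ (⊤ : ℕ∞) u) :
    ContDiff ℝ (⊤ : ℕ∞) (timeDeriv d u) := contDiff_dirDeriv hu _

theorem deriv_comm (d : ℕ) {u : Pt d → ℝ} (hu : ContDiff ℝ (⊤ : ℕ∞) u) (i : Fin d) (z : Pt d) :
    timeDeriv d (spDeriv d i u) z = spDeriv d i (timeDeriv d u) z := by
  have hd : DifferentiableAt ℝ (fderiv ℝ u) z := by
    have : ContDiff ℝ (⊤ : ℕ∞) (fderiv ℝ u) := hu.fderiv_right (by simp)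
    exact this.differentiable (by simp) z
  have hs : IsSymmSndFDerivAt ℝ u z :=
    (hu.contDiffAt (x := z)).isSymmSndFDerivAt (by simp; exact WithTop.coe_le_coe.2 le_top)
  have key : ∀ a b : Pt d, fderiv ℝ (fun y => fderiv ℝ u y a) z b = fderiv ℝ (fderiv ℝ u) z b a := by
    intro a b
    rw [fderiv_clm_apply hd (by fun_prop)]
    simp
  unfold timeDeriv spDeriv
  rw [key, key, hs.eq]

theorem fderiv_space (d : ℕ) (v : Pt d → ℝ) (z : Pt d) (y : Ed d) :
    fderiv ℝ v z (0, y) = ∑ j, y j * spDeriv d j v z := by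
  have : ((0 : ℝ), y) = ∑ j, y j • ((0 : ℝ), EuclideanSpace.single j (1:ℝ)) := by
    refine Prod.ext ?_ ?_
    · simp [Prod.fst_sum]
    · rw [Prod.snd_sum]
      ext k
      simp [Finset.sum_apply, Pi.single_apply]
  rw [this, map_sum]
  apply Finset.sum_congr rfl
  intro j _
  rw [map_smul, smul_eq_mul]
  rfl

theorem fderiv_space_le (d : ℕ) (u : Pt d → ℝ) (i : Fin d) (z : Pt d) (y : Ed d) :
    |fderiv ℝ (spDeriv d i u) z (0, y)| ≤ ‖y‖ * hessNorm d u z := by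
  rw [fderiv_space]
  have h := Finset.sum_mul_sq_le_sq_mul_sq Finset.univ (fun j => y j)
    (fun j => spDeriv d j (spDeriv d i u) z)
  have h1 : ‖y‖ ^ 2 = ∑ j, y j ^ 2 := by
    rw [EuclideanSpace.norm_sq_eq]; simp
  have h2 : ∑ j, spDeriv d j (spDeriv d i u) z ^ 2 ≤ hessNorm d u z ^ 2 := by
    rw [hessNorm, Real.sq_sqrt (by positivity)]
    apply Finset.sum_le_sum
    intro j _
    exact Finset.single_le_sum (f := fun i => spDeriv d j (spDeriv d i u) z ^ 2)
      (fun _ _ => sq_nonneg _) (Finset.mem_univ i)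
  apply abs_le_of_sq_le_sq
  · rw [mul_pow, h1]
    exact h.trans (by gcongr)
  · exact mul_nonneg (norm_nonneg _) (Real.sqrt_nonneg _)

theorem gradNorm_le (d : ℕ) (u : Pt d → ℝ) (z : Pt d) :
    gradNorm d u z ≤ ∑ i, |spDeriv d i u z| := by
  unfold gradNorm
  apply Real.sqrt_le_iff.2 ⟨by positivity, ?_⟩
  calc ∑ i, spDeriv d i u z ^ 2 = ∑ i, |spDeriv d i u z| ^ 2 := by simp
    _ ≤ _ := Finset.sum_sq_le_sq_sum_of_nonneg (fun _ _ => abs_nonneg _)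

/-- Integrability on `E × (0,1]` for continuous functions supported in `K × ℝ`. -/
theorem integrable_strip (d : ℕ) {f : ℝ × Ed d → ℝ} (hf : Continuous f) {K : Set (Ed d)}
    (hK : IsCompact K) (h0 : ∀ p, p.2 ∉ K → f p = 0) :
    Integrable f ((volume.restrict (Set.uIoc (0:ℝ) 1)).prod volume) := by
  have h1 : IntegrableOn f (Icc (0:ℝ) 1 ×ˢ K) (volume.prod volume) :=
    hf.continuousOn.integrableOn_compact (isCompact_Icc.prod hK)
  have h2 : IntegrableOn f (Set.uIoc (0:ℝ) 1 ×ˢ K) (volume.prod volume) :=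
    h1.mono_set (prod_mono (by rw [uIoc_of_le zero_le_one]; exact Ioc_subset_Icc_self) subset_rfl)
  have h3 : IntegrableOn f (univ ×ˢ K) ((volume.restrict (Set.uIoc (0:ℝ) 1)).prod volume) := by
    rw [IntegrableOn, ← Measure.prod_restrict, Measure.restrict_univ, Measure.prod_restrict]
    exact h2
  apply h3.integrable_of_forall_notMem_eq_zero
  intro p hp
  apply h0
  intro h
  exact hp ⟨mem_univ _, h⟩

/-- Path from `z` to the point `(τ, R η)`. -/
def gam (d : ℕ) (R τ : ℝ) (z : Pt d) (ε : ℝ) (η : Ed d) : Pt d :=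
  (z.1 + ε ^ 2 * (τ - z.1), z.2 + ε • (R • η - z.2))

theorem gam_deriv_eps (d : ℕ) (R τ : ℝ) (z : Pt d) (ε : ℝ) (η : Ed d) :
    HasDerivAt (fun ε => gam d R τ z ε η) (2 * ε * (τ - z.1), R • η - z.2) ε := by
  unfold gam
  apply HasDerivAt.prodMk
  · have := (((hasDerivAt_id ε).pow 2).mul_const (τ - z.1)).const_add z.1
    simpa using this
  · have := ((hasDerivAt_id ε).smul_const (R • η - z.2)).const_add z.2
    simpa using this

theorem comp_deriv_eps (d : ℕ) {v : Pt d → ℝ} (hv : ContDiff ℝ (⊤ : ℕ∞) v) (R τ : ℝ) (z : Pt d)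
    (ε : ℝ) (η : Ed d) : HasDerivAt (fun ε => v (gam d R τ z ε η))
      (2 * ε * (τ - z.1) * timeDeriv d v (gam d R τ z ε η) +
        fderiv ℝ v (gam d R τ z ε η) (0, R • η - z.2)) ε := by
  have h1 : HasFDerivAt v (fderiv ℝ v (gam d R τ z ε η)) (gam d R τ z ε η) :=
    (hv.differentiable (by simp) _).hasFDerivAt
  have h2 := h1.comp_hasDerivAt ε (gam_deriv_eps d R τ z ε η)
  have : ((2 * ε * (τ - z.1), R • η - z.2) : Pt d) =
      (2 * ε * (τ - z.1)) • ((1 : ℝ), (0 : Ed d)) + (0, R • η - z.2) := by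
    refine Prod.ext ?_ ?_ <;> simp
  rw [this, map_add, map_smul, smul_eq_mul] at h2
  exact h2

theorem comp_deriv_eta (d : ℕ) {v : Pt d → ℝ} (hv : ContDiff ℝ (⊤ : ℕ∞) v) (R τ : ℝ) (z : Pt d)
    (ε : ℝ) (η : Ed d) (i : Fin d) :
    fderiv ℝ (fun η => v (gam d R τ z ε η)) η (EuclideanSpace.single i 1) =
      ε * R * spDeriv d i v (gam d R τ z ε η) := by
  have h1 : HasFDerivAt v (fderiv ℝ v (gam d R τ z ε η)) (gam d R τ z ε η) :=
    (hv.differentiable (by simp) _).hasFDerivAt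
  have h3 : HasFDerivAt (fun η => gam d R τ z ε η)
      ((0 : Ed d →L[ℝ] ℝ).prod (ε • R • ContinuousLinearMap.id ℝ (Ed d))) η := by
    unfold gam
    apply HasFDerivAt.prodMk
    · exact hasFDerivAt_const _ _
    · exact ((((hasFDerivAt_id η).const_smul R).sub_const z.2).const_smul ε).const_add z.2
  have h2 := h1.comp η h3
  have e : (fun η => v (gam d R τ z ε η)) = v ∘ (fun η => gam d R τ z ε η) := rfl
  rw [e, h2.fderiv]
  have : ((0 : ℝ), ε • R • EuclideanSpace.single i (1:ℝ)) =
      (ε * R) • ((0 : ℝ), EuclideanSpace.single i (1:ℝ)) := by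
    refine Prod.ext ?_ ?_
    · simp
    · simp [smul_smul]
  simp only [ContinuousLinearMap.comp_apply, ContinuousLinearMap.prod_apply,
    ContinuousLinearMap.zero_apply, ContinuousLinearMap.smul_apply, ContinuousLinearMap.id_apply]
  rw [this, map_smul, smul_eq_mul]
  rfl

theorem contDiff_gam (d : ℕ) (R τ : ℝ) (z : Pt d) (ε : ℝ) {n : WithTop ℕ∞} :
    ContDiff ℝ n (fun η => gam d R τ z ε η) := by
  unfold gam; fun_prop

theorem continuous_gam (d : ℕ) (R τ : ℝ) (z : Pt d) :
    Continuous (fun p : ℝ × Ed d => gam d R τ z p.1 p.2) := by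
  unfold gam; fun_prop

theorem spDeriv_repr (d : ℕ) {ψ : Ed d → ℝ} (hψ : ContDiff ℝ 1 ψ) (hs : HasCompactSupport ψ)
    (hψ1 : ∫ x, ψ x = 1) {u : Pt d → ℝ} (hu : ContDiff ℝ (⊤ : ℕ∞) u) (i : Fin d) {R : ℝ}
    (hR : 0 < R) (τ : ℝ) (z : Pt d) :
    spDeriv d i u z =
      -(R⁻¹ * ∫ η, fderiv ℝ ψ η (EuclideanSpace.single i 1) * u (gam d R τ z 1 η)) -
      ∫ ε in (0:ℝ)..1, ∫ η, (-(2 * (τ - z.1) / R * (fderiv ℝ ψ η (EuclideanSpace.single i 1) *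
          timeDeriv d u (gam d R τ z ε η))) +
        ψ η * fderiv ℝ (spDeriv d i u) (gam d R τ z ε η) (0, R • η - z.2)) := by
  set v := spDeriv d i u with hv
  have hvs : ContDiff ℝ (⊤ : ℕ∞) v := contDiff_spDeriv d hu i
  have hut : ContDiff ℝ (⊤ : ℕ∞) (timeDeriv d u) := contDiff_timeDeriv d hu
  have hvt : ContDiff ℝ (⊤ : ℕ∞) (timeDeriv d v) := contDiff_timeDeriv d hvs
  have hg := continuous_gam d R τ z
  have cfd : Continuous (fderiv ℝ v) := hvs.continuous_fderiv (by simp)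
  have cψ := hψ.continuous
  have c1 : Continuous fun p : ℝ × Ed d => timeDeriv d v (gam d R τ z p.1 p.2) :=
    hvt.continuous.comp hg
  have c2 : Continuous fun p : ℝ × Ed d =>
      fderiv ℝ v (gam d R τ z p.1 p.2) (0, R • p.2 - z.2) :=
    (cfd.comp hg).clm_apply (by fun_prop)
  have cψd : Continuous fun η => fderiv ℝ ψ η (EuclideanSpace.single i 1) := by
    have := hψ.continuous_fderiv (by simp); fun_prop
  have c3 : Continuous fun p : ℝ × Ed d => timeDeriv d u (gam d R τ z p.1 p.2) :=
    hut.continuous.comp hg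
  let g : ℝ → Ed d → ℝ := fun ε η => 2 * ε * (τ - z.1) * timeDeriv d v (gam d R τ z ε η) +
        fderiv ℝ v (gam d R τ z ε η) (0, R • η - z.2)
  have cg : Continuous fun p : ℝ × Ed d => g p.1 p.2 := by
    simp only [g]; exact (by fun_prop : Continuous fun p : ℝ × Ed d => 2 * p.1 * (τ - z.1)).mul c1 |>.add c2
  have ftc : ∀ η, ∫ ε in (0:ℝ)..1, g ε η = v (gam d R τ z 1 η) - v z := by
    intro η
    have := intervalIntegral.integral_eq_sub_of_hasDerivAt (a := 0) (b := 1)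
      (f := fun ε => v (gam d R τ z ε η)) (f' := fun ε => g ε η)
      (fun ε _ => comp_deriv_eps d hvs R τ z ε η)
      ((cg.comp (by fun_prop : Continuous fun ε : ℝ => (ε, η))).intervalIntegrable _ _)
    rw [this]
    simp [gam]
  have swap : ∫ ε in (0:ℝ)..1, ∫ η, ψ η * g ε η = ∫ η, ∫ ε in (0:ℝ)..1, ψ η * g ε η := by
    apply intervalIntegral_integral_swap
    apply integrable_strip d (K := tsupport ψ) _ hs
    · intro p hp
      simp [Function.uncurry, image_eq_zero_of_notMem_tsupport hp]
    · exact (cψ.comp continuous_snd).mul cg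
  have cv1 : Continuous fun η => v (gam d R τ z 1 η) :=
    hvs.continuous.comp (contDiff_gam d R τ z 1 (n := 0)).continuous
  have lhs : ∫ η, ∫ ε in (0:ℝ)..1, ψ η * g ε η = (∫ η, ψ η * v (gam d R τ z 1 η)) - v z := by
    simp_rw [intervalIntegral.integral_const_mul, ftc, mul_sub]
    rw [integral_sub, integral_mul_const, hψ1, one_mul]
    · exact (cψ.mul cv1).integrable_of_hasCompactSupport hs.mul_right
    · exact (cψ.mul continuous_const).integrable_of_hasCompactSupport hs.mul_right
  have first : ∫ η, ψ η * v (gam d R τ z 1 η) =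
      -(R⁻¹ * ∫ η, fderiv ℝ ψ η (EuclideanSpace.single i 1) * u (gam d R τ z 1 η)) := by
    have := ibp d hψ hs (G := fun η => u (gam d R τ z 1 η))
      ((hu.of_le (by exact WithTop.coe_le_coe.2 le_top)).comp (contDiff_gam d R τ z 1))
      (EuclideanSpace.single i 1)
    simp_rw [comp_deriv_eta d hu] at this
    rw [← mul_neg, ← this, ← integral_const_mul]
    congr 1
    ext η
    simp only [hv, one_mul]
    field_simp
  have second : ∀ ε, ∫ η, ψ η * g ε η =
      ∫ η, (-(2 * (τ - z.1) / R * (fderiv ℝ ψ η (EuclideanSpace.single i 1) *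
          timeDeriv d u (gam d R τ z ε η))) +
        ψ η * fderiv ℝ v (gam d R τ z ε η) (0, R • η - z.2)) := by
    intro ε
    have hi : Continuous fun η : Ed d => (ε, η) := by fun_prop
    have i1 : Integrable fun η => ψ η * (ε * R * spDeriv d i (timeDeriv d u) (gam d R τ z ε η)) := by
      refine Continuous.integrable_of_hasCompactSupport ?_ hs.mul_right
      exact cψ.mul (continuous_const.mul
        ((contDiff_spDeriv d hut i).continuous.comp (hg.comp hi)))
    have i2 : Integrable fun η => ψ η * fderiv ℝ v (gam d R τ z ε η) (0, R • η - z.2) :=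
      (cψ.mul (c2.comp hi)).integrable_of_hasCompactSupport hs.mul_right
    have i3 : Integrable fun η => (fderiv ℝ ψ η (EuclideanSpace.single i 1) *
          timeDeriv d u (gam d R τ z ε η)) :=
      (cψd.mul (c3.comp hi)).integrable_of_hasCompactSupport (hs.fderiv_apply ℝ _).mul_right
    have := ibp d hψ hs (G := fun η => timeDeriv d u (gam d R τ z ε η))
      ((hut.of_le (by exact WithTop.coe_le_coe.2 le_top)).comp (contDiff_gam d R τ z ε))
      (EuclideanSpace.single i 1)
    simp_rw [comp_deriv_eta d hut] at this
    have i4 : Integrable fun η => -(2 * (τ - z.1) / R *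
        (fderiv ℝ ψ η (EuclideanSpace.single i 1) * timeDeriv d u (gam d R τ z ε η))) :=
      (i3.const_mul _).neg
    rw [integral_add i4 i2, integral_neg, integral_const_mul,
      ← mul_neg, ← this, ← integral_const_mul, ← integral_add (i1.const_mul _) i2]
    congr 1
    ext η
    simp only [g, hv, deriv_comm d hu i]
    field_simp
  simp_rw [← second]
  rw [swap, lhs, first]
  ring

theorem pointwise1 (d : ℕ) {ψ : Ed d → ℝ} {C : ℝ} (hC : 0 < C) (hψ : ContDiff ℝ 1 ψ)
    (hs : HasCompactSupport ψ) (hball : tsupport ψ ⊆ Metric.ball 0 1)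
    (hψ1 : ∫ x, ψ x = 1) (hb1 : ∀ x, |ψ x| ≤ C) (hb2 : ∀ x, ‖fderiv ℝ ψ x‖ ≤ C)
    {u : Pt d → ℝ} (hu : ContDiff ℝ (⊤ : ℕ∞) u) (i : Fin d) {R : ℝ}
    (hR : 0 < R) {τ : ℝ} (hτ : τ ∈ Ico 0 (R ^ 2)) {z : Pt d} (hz : z ∈ pCyl d R 0) :
    ENNReal.ofReal |spDeriv d i u z| ≤
      ENNReal.ofReal (C * R⁻¹) *
        (∫⁻ η in Metric.ball (0 : Ed d) 1, ENNReal.ofReal |u (gam d R τ z 1 η)|) +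
      ENNReal.ofReal (2 * C * R) * ∫⁻ ε in Ioo (0:ℝ) 1, ∫⁻ η in Metric.ball (0 : Ed d) 1,
        ENNReal.ofReal (|timeDeriv d u (gam d R τ z ε η)| + hessNorm d u (gam d R τ z ε η)) := by
  obtain ⟨z1, z2, z3⟩ := hz
  simp only [Prod.fst_zero, Prod.snd_zero, zero_add, dist_zero_left] at z1 z2 z3
  have hout : ∀ η ∉ Metric.ball (0 : Ed d) 1, ψ η = 0 ∧ fderiv ℝ ψ η = 0 := by
    intro η hη
    refine ⟨image_eq_zero_of_notMem_tsupport fun h => hη (hball h),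
      image_eq_zero_of_notMem_tsupport fun h => hη (hball (tsupport_fderiv_subset ℝ h))⟩
  have hdir : ∀ η, |fderiv ℝ ψ η (EuclideanSpace.single i 1)| ≤ C := by
    intro η
    have := (fderiv ℝ ψ η).le_opNorm (EuclideanSpace.single i 1)
    simp only [EuclideanSpace.norm_single, norm_one, mul_one] at this
    exact this.trans (hb2 η)
  rw [spDeriv_repr d hψ hs hψ1 hu i hR τ z, ← Real.enorm_eq_ofReal_abs]
  refine (enorm_sub_le).trans (add_le_add ?_ ?_)
  · rw [enorm_neg, ← integral_const_mul]
    refine (enorm_integral_le_lintegral_enorm _).trans ?_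
    rw [← lintegral_const_mul' _ _ ENNReal.ofReal_ne_top,
      ← lintegral_indicator Metric.isOpen_ball.measurableSet]
    apply lintegral_mono
    intro η
    by_cases hη : η ∈ Metric.ball (0 : Ed d) 1
    · beta_reduce
      rw [indicator_of_mem hη, Real.enorm_eq_ofReal_abs, ← ENNReal.ofReal_mul (by positivity)]
      apply ENNReal.ofReal_le_ofReal
      rw [abs_mul, abs_mul, abs_of_pos (inv_pos.2 hR), ← mul_assoc, mul_comm C]
      gcongr
      exact hdir η
    · simp [(hout η hη).2]
  · rw [intervalIntegral.integral_of_le zero_le_one, integral_Ioc_eq_integral_Ioo]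
    refine (enorm_integral_le_lintegral_enorm _).trans ?_
    rw [← lintegral_const_mul' _ _ ENNReal.ofReal_ne_top]
    apply lintegral_mono
    intro ε
    refine (enorm_integral_le_lintegral_enorm _).trans ?_
    simp only
    rw [← lintegral_const_mul' _ _ ENNReal.ofReal_ne_top,
      ← lintegral_indicator Metric.isOpen_ball.measurableSet]
    apply lintegral_mono
    intro η
    by_cases hη : η ∈ Metric.ball (0 : Ed d) 1
    · beta_reduce
      rw [indicator_of_mem hη, Real.enorm_eq_ofReal_abs, ← ENNReal.ofReal_mul (by positivity)]
      apply ENNReal.ofReal_le_ofReal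
      rw [mem_ball_zero_iff] at hη
      have hy : ‖R • η - z.2‖ ≤ 2 * R := by
        have := norm_sub_le (R • η) z.2
        rw [norm_smul, Real.norm_eq_abs, abs_of_pos hR] at this
        nlinarith
      have k1 := fderiv_space_le d u i (gam d R τ z ε η) (R • η - z.2)
      have hH : 0 ≤ hessNorm d u (gam d R τ z ε η) := Real.sqrt_nonneg _
      have k2 : |ψ η * fderiv ℝ (spDeriv d i u) (gam d R τ z ε η) (0, R • η - z.2)| ≤
          C * (2 * R * hessNorm d u (gam d R τ z ε η)) := by
        rw [abs_mul]
        exact mul_le_mul (hb1 η) (k1.trans (by gcongr)) (abs_nonneg _) hC.le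
      have k3 : |2 * (τ - z.1) / R| ≤ 2 * R := by
        rw [abs_div, abs_of_pos hR, div_le_iff₀ hR, abs_le]
        constructor <;> nlinarith [hτ.1, hτ.2]
      have k4 : |(-(2 * (τ - z.1) / R * (fderiv ℝ ψ η (EuclideanSpace.single i 1) *
          timeDeriv d u (gam d R τ z ε η))))| ≤ 2 * R * (C * |timeDeriv d u (gam d R τ z ε η)|) := by
        rw [abs_neg, abs_mul, abs_mul (fderiv ℝ ψ η (EuclideanSpace.single i 1))]
        have := hdir η
        gcongr
      refine (abs_add_le _ _).trans ((add_le_add k4 k2).trans (le_of_eq (by ring)))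
    · simp [(hout η hη).1, (hout η hη).2]

theorem meas_gam (d : ℕ) (R : ℝ) (z : Pt d) {h : Pt d → ℝ≥0∞} (hh : Measurable h) :
    Measurable fun p : (ℝ × ℝ) × Ed d => h (gam d R (R ^ 2 * p.1.1) z p.1.2 p.2) := by
  have : Continuous fun p : (ℝ × ℝ) × Ed d => gam d R (R ^ 2 * p.1.1) z p.1.2 p.2 := by
    unfold gam; fun_prop
  exact hh.comp this.measurable

theorem meas_gam_int (d : ℕ) (R : ℝ) (z : Pt d) {h : Pt d → ℝ≥0∞} (hh : Measurable h) :
    Measurable fun p : ℝ × ℝ =>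
      ∫⁻ η in Metric.ball (0 : Ed d) 1, h (gam d R (R ^ 2 * p.1) z p.2 η) :=
  (meas_gam d R z hh).lintegral_prod_right'

theorem Fp_eq (d : ℕ) (R : ℝ) {h : Pt d → ℝ≥0∞} (hh : Measurable h) (ε : ℝ) (z : Pt d) :
    Fp d R h ε z = ∫⁻ σ in Ico (0:ℝ) 1, ∫⁻ η in Metric.ball (0 : Ed d) 1,
      h (gam d R (R ^ 2 * σ) z ε η) := by
  unfold Fp
  have e : pCyl d 1 0 = Ico (0:ℝ) 1 ×ˢ Metric.ball (0 : Ed d) 1 := by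
    rw [pCyl_eq]; simp
  rw [e, Measure.volume_eq_prod, ← Measure.prod_restrict, lintegral_prod]
  · rfl
  · have : Continuous fun w : Pt d => Tm d R ε z w := by unfold Tm; fun_prop
    exact (hh.comp this.measurable).aemeasurable

theorem continuous_hessNorm (d : ℕ) {u : Pt d → ℝ} (hu : ContDiff ℝ (⊤ : ℕ∞) u) :
    Continuous (hessNorm d u) := by
  unfold hessNorm
  have : ∀ i j, Continuous (spDeriv d i (spDeriv d j u)) := fun i j =>
    (contDiff_spDeriv d (contDiff_spDeriv d hu j) i).continuous
  fun_prop

theorem continuous_gradNorm (d : ℕ) {u : Pt d → ℝ} (hu : ContDiff ℝ (⊤ : ℕ∞) u) :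
    Continuous (gradNorm d u) := by
  unfold gradNorm
  have : ∀ i, Continuous (spDeriv d i u) := fun i => (contDiff_spDeriv d hu i).continuous
  fun_prop

theorem continuous_ff (d : ℕ) {u : Pt d → ℝ} (hu : ContDiff ℝ (⊤ : ℕ∞) u) :
    Continuous (fun z => |timeDeriv d u z| + hessNorm d u z) :=
  (contDiff_timeDeriv d hu).continuous.abs.add (continuous_hessNorm d hu)

theorem avg_swap {k1 k2 : ℝ × ℝ → ℝ≥0∞} (h1 : Measurable k1) (h2 : Measurable k2) (a b : ℝ≥0∞) :
    ∫⁻ σ in Ico (0:ℝ) 1, (a * k1 (σ, 1) + b * ∫⁻ ε in Ioo (0:ℝ) 1, k2 (σ, ε)) =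
      a * (∫⁻ σ in Ico (0:ℝ) 1, k1 (σ, 1)) +
        b * ∫⁻ ε in Ioo (0:ℝ) 1, ∫⁻ σ in Ico (0:ℝ) 1, k2 (σ, ε) := by
  have m1 : Measurable fun σ : ℝ => k1 (σ, 1) := h1.comp (by fun_prop)
  have m2 : Measurable fun σ : ℝ => ∫⁻ ε in Ioo (0:ℝ) 1, k2 (σ, ε) := h2.lintegral_prod_right'
  rw [lintegral_add_left (m1.const_mul _), lintegral_const_mul _ m1, lintegral_const_mul _ m2,
    lintegral_lintegral_swap (f := fun σ ε => k2 (σ, ε)) h2.aemeasurable]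

theorem pointwise2 (d : ℕ) : ∃ C : ℝ, 0 < C ∧ ∀ (u : Pt d → ℝ), ContDiff ℝ (⊤ : ℕ∞) u →
    ∀ R : ℝ, 0 < R → ∀ z ∈ pCyl d R 0, ENNReal.ofReal (gradNorm d u z) ≤
      d * (ENNReal.ofReal (C * R⁻¹) * Fp d R (fun z => ENNReal.ofReal |u z|) 1 z +
        ENNReal.ofReal (2 * C * R) * ∫⁻ ε in Ioo (0:ℝ) 1,
          Fp d R (fun z => ENNReal.ofReal (|timeDeriv d u z| + hessNorm d u z)) ε z) := by
  obtain ⟨ψ, C, hC, h1, h2, h3, h4, h5, h6⟩ := bump_exists d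
  refine ⟨C, hC, fun u hu R hR z hz => ?_⟩
  have mu : Measurable (fun z => ENNReal.ofReal |u z|) := hu.continuous.abs.measurable.ennreal_ofReal
  have mf : Measurable (fun z => ENNReal.ofReal (|timeDeriv d u z| + hessNorm d u z)) :=
    (continuous_ff d hu).measurable.ennreal_ofReal
  have key : ∀ i : Fin d, ENNReal.ofReal |spDeriv d i u z| ≤
      (ENNReal.ofReal (C * R⁻¹) * Fp d R (fun z => ENNReal.ofReal |u z|) 1 z +
        ENNReal.ofReal (2 * C * R) * ∫⁻ ε in Ioo (0:ℝ) 1,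
          Fp d R (fun z => ENNReal.ofReal (|timeDeriv d u z| + hessNorm d u z)) ε z) := by
    intro i
    have m1 := meas_gam_int d R z mu
    have m2 := meas_gam_int d R z mf
    simp_rw [Fp_eq d R mu, Fp_eq d R mf]
    calc ENNReal.ofReal |spDeriv d i u z|
        = ∫⁻ σ in Ico (0:ℝ) 1, ENNReal.ofReal |spDeriv d i u z| := by simp
      _ ≤ ∫⁻ σ in Ico (0:ℝ) 1, (ENNReal.ofReal (C * R⁻¹) *
        (∫⁻ η in Metric.ball (0 : Ed d) 1, ENNReal.ofReal |u (gam d R (R ^ 2 * σ) z 1 η)|) +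
      ENNReal.ofReal (2 * C * R) * ∫⁻ ε in Ioo (0:ℝ) 1, ∫⁻ η in Metric.ball (0 : Ed d) 1,
        ENNReal.ofReal (|timeDeriv d u (gam d R (R ^ 2 * σ) z ε η)| +
          hessNorm d u (gam d R (R ^ 2 * σ) z ε η))) := by
          refine setLIntegral_mono' measurableSet_Ico fun σ hσ => ?_
          refine pointwise1 d hC h1 h2 h3 h4 h5 h6 hu i hR ?_ hz
          have : 0 < R ^ 2 := by positivity
          exact ⟨mul_nonneg this.le hσ.1, by nlinarith [hσ.2]⟩
      _ = _ := by
          exact avg_swap m1 m2 _ _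
  calc ENNReal.ofReal (gradNorm d u z) ≤ ENNReal.ofReal (∑ i, |spDeriv d i u z|) :=
        ENNReal.ofReal_le_ofReal (gradNorm_le d u z)
    _ = ∑ i, ENNReal.ofReal |spDeriv d i u z| :=
        ENNReal.ofReal_sum_of_nonneg fun _ _ => abs_nonneg _
    _ ≤ ∑ i : Fin d, _ := Finset.sum_le_sum fun i _ => key i
    _ = _ := by rw [Finset.sum_const, Finset.card_univ, Fintype.card_fin, nsmul_eq_mul]

theorem add3_rpow {r : ℝ} (hr : 0 < r) (x y w : ℝ≥0∞) :
    (x + y + w) ^ r ≤ 3 ^ r * (x ^ r + y ^ r + w ^ r) := by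
  have h : x + y + w ≤ 3 * max x (max y w) := by
    calc x + y + w ≤ max x (max y w) + max x (max y w) + max x (max y w) := by
          gcongr <;> simp
      _ = _ := by ring
  refine (ENNReal.rpow_le_rpow h hr.le).trans ?_
  rw [ENNReal.mul_rpow_of_nonneg _ _ hr.le]
  gcongr
  rcases max_choice x (max y w) with h1 | h1
  · rw [h1, add_assoc]; exact le_self_add
  · rw [h1]
    rcases max_choice y w with h2 | h2
    · rw [h2]; exact le_add_self.trans le_self_add
    · rw [h2]; exact le_add_self

theorem theta_bound (d : ℕ) {β r R ρ : ℝ} (hβ : 1 < β) (hr : 0 < r) (hrd : r * (β - 1) ≤ d + 2)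
    (hR : 0 < R) (hρ : 0 < ρ) (z0 : Pt d) :
    ENNReal.ofReal (ρ ^ (β - 1)) *
      ((cylV d ρ)⁻¹ * volume (pCyl d ρ z0 ∩ pCyl d R 0)) ^ (1 / r) ≤ ENNReal.ofReal (R ^ (β - 1)) := by
  have v0 := cylV_ne_zero d hρ
  have vt := cylV_ne_top d ρ
  have hr' : 0 ≤ 1 / r := by positivity
  rcases le_total ρ R with h | h
  · have : (cylV d ρ)⁻¹ * volume (pCyl d ρ z0 ∩ pCyl d R 0) ≤ 1 := by
      calc _ ≤ (cylV d ρ)⁻¹ * volume (pCyl d ρ z0) := by gcongr; exact inter_subset_left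
        _ = 1 := by rw [vol_pCyl d hρ, ENNReal.inv_mul_cancel v0 vt]
    calc _ ≤ ENNReal.ofReal (R ^ (β - 1)) * 1 ^ (1 / r) := by
          gcongr
      _ = _ := by simp
  · have hx : 0 < R / ρ := by positivity
    have hx1 : R / ρ ≤ 1 := by rw [div_le_one hρ]; exact h
    have : (cylV d ρ)⁻¹ * volume (pCyl d ρ z0 ∩ pCyl d R 0) ≤ ENNReal.ofReal ((R / ρ) ^ (d + 2)) := by
      calc _ ≤ (cylV d ρ)⁻¹ * volume (pCyl d R 0) := by gcongr; exact inter_subset_right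
        _ = (cylV d ρ)⁻¹ * cylV d (R / ρ * ρ) := by
          rw [vol_pCyl d hR, div_mul_cancel₀ _ hρ.ne']
        _ = ENNReal.ofReal ((R / ρ) ^ (d + 2)) * ((cylV d ρ)⁻¹ * cylV d ρ) := by
          rw [cylV_mul d hx.le]; ring
        _ = _ := by rw [ENNReal.inv_mul_cancel v0 vt, mul_one]
    calc _ ≤ ENNReal.ofReal (ρ ^ (β - 1)) * ENNReal.ofReal ((R / ρ) ^ (d + 2)) ^ (1 / r) := by
          gcongr
      _ = ENNReal.ofReal (ρ ^ (β - 1) * (R / ρ) ^ (((d : ℝ) + 2) / r)) := by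
          rw [ENNReal.ofReal_rpow_of_nonneg (by positivity) hr', ← ENNReal.ofReal_mul (by positivity),
            ← Real.rpow_natCast, ← Real.rpow_mul hx.le]
          congr 3
          push_cast; ring
      _ ≤ ENNReal.ofReal (ρ ^ (β - 1) * (R / ρ) ^ (β - 1)) := by
          apply ENNReal.ofReal_le_ofReal
          gcongr ?_ * ?_
          apply Real.rpow_le_rpow_of_exponent_ge hx hx1
          rw [le_div_iff₀ hr]; linarith
      _ = _ := by
          rw [← Real.mul_rpow hρ.le hx.le, mul_div_cancel₀ _ hρ.ne']

theorem int_g (d : ℕ) {q β R ρ : ℝ} (hq : 1 < q) (hβ : 0 < β) (hρ : 0 < ρ) 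
    {f : Pt d → ℝ≥0∞} {z1 : Pt d} (hz1 : z1 ∈ pCyl d R 0) :
    ∫⁻ z, ((pCyl d (3 * ρ) z1 ∩ pCyl d R 0).indicator f z) ^ q ≤
      ENNReal.ofReal (3 ^ (d + 2)) * cylV d ρ *
        (ENNReal.ofReal (ρ ^ (-β)) * MorreyNorm d q β (pCyl d R 0) f) ^ q := by
  have hq0 : 0 < q := by linarith
  have h3 : 0 < 3 * ρ := by positivity
  have h := morrey_avg d q β (pCyl d R 0) f h3 hz1
  have h' := ENNReal.rpow_le_rpow h hq0.le
  rw [← ENNReal.rpow_mul, one_div_mul_cancel hq0.ne', ENNReal.rpow_one] at h'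
  have e : ∫⁻ z, ((pCyl d (3 * ρ) z1 ∩ pCyl d R 0).indicator f z) ^ q =
      cylV d (3 * ρ) * pAvg d (3 * ρ) z1 (fun w => (pCyl d R 0).indicator f w ^ q) := by
    unfold pAvg
    rw [vol_pCyl d h3, ← mul_assoc, ENNReal.mul_inv_cancel (cylV_ne_zero d h3) (cylV_ne_top d _),
      one_mul, ← lintegral_indicator (measurableSet_pCyl _ _ _)]
    congr 1
    ext z
    rw [← indicator_indicator]
    by_cases hz : z ∈ pCyl d (3 * ρ) z1
    · simp [hz]
    · simp [hz, hq0]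
  rw [e, cylV_mul d (by norm_num)]
  refine mul_le_mul_right (h'.trans ?_) _
  gcongr (ENNReal.ofReal ?_ * _) ^ q
  rw [Real.rpow_neg hρ.le, Real.rpow_neg h3.le]
  gcongr
  linarith

theorem pw3 (d : ℕ) {q β : ℝ} (hq : 1 < q) (hβ : 1 < β) : ∃ c : ℝ≥0∞, c ≠ ∞ ∧
    ∀ (u : Pt d → ℝ), ContDiff ℝ (⊤ : ℕ∞) u →
    ∀ R : ℝ, 0 < R → ∀ ρ : ℝ, 0 < ρ → ∀ z0 : Pt d, ∀ z ∈ pCyl d ρ z0, z ∈ pCyl d R 0 →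
    ENNReal.ofReal (gradNorm d u z) ≤ c * (
      ENNReal.ofReal (R ^ (-1 - β)) *
        MorreyNorm d q β (pCyl d R 0) (fun z => ENNReal.ofReal |u z|) +
      MorreyNorm d q β (pCyl d R 0)
        (fun z => ENNReal.ofReal (|timeDeriv d u z| + hessNorm d u z)) * ENNReal.ofReal (ρ ^ (1 - β)) +
      MorreyNorm d q β (pCyl d R 0)
        (fun z => ENNReal.ofReal (|timeDeriv d u z| + hessNorm d u z)) ^ (1 / β) *
      cMax d (2 * ρ) ((pCyl d (3 * ρ) (max 0 (z0.1 - ρ ^ 2), z0.2) ∩ pCyl d R 0).indicator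
        (fun z => ENNReal.ofReal (|timeDeriv d u z| + hessNorm d u z))) z ^ (1 - 1 / β)) := by
  obtain ⟨C, hC, H⟩ := pointwise2 d
  have hβ0 : 0 < β := by linarith
  have hb1 : 0 ≤ 1 / β := by positivity
  have hb2 : 0 ≤ 1 - 1 / β := by
    rw [sub_nonneg, div_le_one hβ0]; exact hβ.le
  set A0 : ℝ≥0∞ := ENNReal.ofReal (2 ^ (d + 2)) * ubV d with hA0
  set B0 : ℝ≥0∞ := 2 * ENNReal.ofReal (4 ^ (d + 2)) * ubV d with hB0
  have hA0t : A0 ≠ ∞ := ENNReal.mul_ne_top ENNReal.ofReal_ne_top (ubV_ne_top d)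
  have hB0t : B0 ≠ ∞ := ENNReal.mul_ne_top (ENNReal.mul_ne_top (by simp) ENNReal.ofReal_ne_top)
    (ubV_ne_top d)
  set h0 : ℝ≥0∞ := ENNReal.ofReal (1 + 1 / (β - 1))
  refine ⟨d * (ENNReal.ofReal C * A0 + ENNReal.ofReal (2 * C) * h0 * 
    (A0 ^ (1 / β) * B0 ^ (1 - 1 / β) + A0)), ?_, ?_⟩
  · have t1 := ENNReal.rpow_ne_top_of_nonneg hb1 hA0t
    have t2 := ENNReal.rpow_ne_top_of_nonneg hb2 hB0t
    finiteness
  intro u hu R hR ρ hρ z0 z hz0 hz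
  have mu : Measurable (fun z => ENNReal.ofReal |u z|) := hu.continuous.abs.measurable.ennreal_ofReal
  have mf : Measurable (fun z => ENNReal.ofReal (|timeDeriv d u z| + hessNorm d u z)) :=
    (continuous_ff d hu).measurable.ennreal_ofReal
  refine (H u hu R hR z hz).trans ?_
  set f := (fun z => ENNReal.ofReal (|timeDeriv d u z| + hessNorm d u z)) with hf
  set U := MorreyNorm d q β (pCyl d R 0) (fun z => ENNReal.ofReal |u z|)
  set K := MorreyNorm d q β (pCyl d R 0) f
  set M := cMax d (2 * ρ) ((pCyl d (3 * ρ) (max 0 (z0.1 - ρ ^ 2), z0.2) ∩ pCyl d R 0).indicator f) z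
  have e1 : ENNReal.ofReal (C * R⁻¹) * Fp d R (fun z => ENNReal.ofReal |u z|) 1 z ≤
      ENNReal.ofReal C * A0 * (ENNReal.ofReal (R ^ (-1 - β)) * U) := by
    have := Fp_le_morrey d hq hβ0 hR one_pos le_rfl mu hz
    rw [one_mul] at this
    calc _ ≤ _ := mul_le_mul_right this _
      _ = _ := by
        rw [ENNReal.ofReal_mul hC.le, sub_eq_add_neg, Real.rpow_add hR, Real.rpow_neg_one,
          ENNReal.ofReal_mul (by positivity)]
        ring
  have e2 := hedberg (A := A0 * K) (B := B0 * M) (F := fun ε => Fp d R f ε z) hβ hR hρ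
    (fun ε hε => Fp_le_morrey d hq hβ0 hR hε.1 hε.2.le mf hz)
    (fun ε hε h => Fp_le_cMax d hR hε.1 hε.2.le hρ h mf hz hz0)
  have e3 : ENNReal.ofReal (2 * C * R) * ∫⁻ ε in Ioo (0:ℝ) 1, Fp d R f ε z ≤
      ENNReal.ofReal (2 * C) * h0 * (A0 ^ (1 / β) * B0 ^ (1 - 1 / β) * (K ^ (1 / β) * M ^ (1 - 1 / β))
        + A0 * (K * ENNReal.ofReal (ρ ^ (1 - β)))) := by
    rw [ENNReal.ofReal_mul (by positivity), mul_assoc]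
    calc _ ≤ _ := mul_le_mul_right e2 _
      _ = _ := by
        rw [ENNReal.mul_rpow_of_nonneg _ _ hb1, ENNReal.mul_rpow_of_nonneg _ _ hb2]
        ring
  rw [mul_assoc (d : ℝ≥0∞)]
  refine mul_le_mul_right ((add_le_add e1 e3).trans ?_) _
  generalize ENNReal.ofReal (R ^ (-1 - β)) * U = x
  generalize K * ENNReal.ofReal (ρ ^ (1 - β)) = y
  generalize K ^ (1 / β) * M ^ (1 - 1 / β) = w
  rw [add_mul, mul_assoc (ENNReal.ofReal (2 * C) * h0), add_mul]
  gcongr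
  · rw [add_assoc]; exact le_self_add
  · exact le_add_self
  · exact le_add_self.trans le_self_add

theorem bdd_on_cyl (d : ℕ) (R : ℝ) {f : Pt d → ℝ} (hf : Continuous f) :
    ∃ c : ℝ, ∀ z ∈ pCyl d R 0, f z ≤ c := by
  have hc : IsCompact (Icc (0:ℝ) (R ^ 2) ×ˢ Metric.closedBall (0 : Ed d) R) :=
    isCompact_Icc.prod (isCompact_closedBall _ _)
  obtain ⟨c, hc⟩ := hc.bddAbove_image hf.continuousOn
  refine ⟨c, fun z hz => hc ⟨z, ?_, rfl⟩⟩
  obtain ⟨h1, h2, h3⟩ := hz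
  simp only [Prod.fst_zero, Prod.snd_zero, zero_add] at h1 h2 h3
  exact ⟨⟨h2, h3.le⟩, by rw [Metric.mem_closedBall, dist_comm]; exact h1.le⟩

theorem base1_mem (d : ℕ) {R ρ : ℝ} (hR : 0 < R) {z0 : Pt d} (hz0 : z0 ∈ pCyl d R 0) :
    ((max 0 (z0.1 - ρ ^ 2), z0.2) : Pt d) ∈ pCyl d R 0 := by
  obtain ⟨h1, h2, h3⟩ := hz0
  refine ⟨h1, le_max_left _ _, ?_⟩
  simp only [Prod.fst_zero, zero_add] at *
  have : 0 < R ^ 2 := by positivity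
  exact max_lt this (by nlinarith [sq_nonneg ρ])

theorem main_ennreal (d : ℕ) (q β r : ℝ) (hq : 1 < q)
    (hβ : 1 < β) (hβ' : β ≤ ((d : ℝ) + 2) / q) (hr : r * (β - 1) = q * β) :
    ∃ N : ℝ≥0∞, N ≠ ∞ ∧ ∀ R : ℝ, 0 < R →
      ∀ u : Pt d → ℝ, ContDiff ℝ (⊤ : ℕ∞) u →
        MorreyNorm d r (β - 1) (pCyl d R 0) (fun z => ENNReal.ofReal (gradNorm d u z)) ≤
          N * MorreyNorm d q β (pCyl d R 0)
              (fun z => ENNReal.ofReal (|timeDeriv d u z| + hessNorm d u z)) +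
            N * ENNReal.ofReal (R ^ (-2 : ℝ)) * MorreyNorm d q β (pCyl d R 0)
              (fun z => ENNReal.ofReal |u z|) := by
  obtain ⟨c, hc, H⟩ := pw3 d hq hβ
  have hβ0 : 0 < β := by linarith
  have hq0 : 0 < q := by linarith
  have hβ1 : 0 < β - 1 := by linarith
  have hr0 : 0 < r := by
    by_contra h
    push Not at h
    nlinarith [mul_pos hq0 hβ0, mul_nonneg (neg_nonneg.2 h) hβ1.le]
  have hrq : r - q = 1 / β * r := by field_simp; linarith
  have hrq' : q = (1 - 1 / β) * r := by rw [sub_mul, ← hrq]; ring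
  have hrq0 : 0 ≤ r - q := by rw [hrq]; positivity
  have hr1 : 1 ≤ r := by linarith
  have hrd : r * (β - 1) ≤ d + 2 := by
    rw [hr]; rw [le_div_iff₀ hq0] at hβ'; linarith
  have hir : 0 ≤ 1 / r := by positivity
  set S : ℝ≥0∞ := ENNReal.ofReal (q * (3 ^ (d + 2) * 2 * (2 ^ (q - 1) / (q - 1)))) with hS
  set S3 : ℝ≥0∞ := S * ENNReal.ofReal (3 ^ (d + 2)) with hS3
  set c2 : ℝ≥0∞ := (1 + S3) ^ (1 / r) with hc2
  have hc2t : c2 ≠ ∞ := by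
    apply ENNReal.rpow_ne_top_of_nonneg hir
    simp only [hS3, hS]; finiteness
  refine ⟨3 * c * (1 + c2), by finiteness, fun R hR u hu => ?_⟩
  have H' := H u hu R hR
  have mf : Measurable (fun z => ENNReal.ofReal (|timeDeriv d u z| + hessNorm d u z)) :=
    (continuous_ff d hu).measurable.ennreal_ofReal
  obtain ⟨cb, hcb⟩ := bdd_on_cyl d R (continuous_ff d hu)
  have hcb' : ∀ z ∈ pCyl d R 0,
    ENNReal.ofReal (|timeDeriv d u z| + hessNorm d u z) ≤ ENNReal.ofReal cb :=
    fun z hz => ENNReal.ofReal_le_ofReal (hcb z hz)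
  set f := (fun z => ENNReal.ofReal (|timeDeriv d u z| + hessNorm d u z)) with hf
  set U := MorreyNorm d q β (pCyl d R 0) (fun z => ENNReal.ofReal |u z|)
  set K := MorreyNorm d q β (pCyl d R 0) f
  set Q := pCyl d R 0 with hQ
  conv_lhs => unfold MorreyNorm
  refine iSup₂_le fun ρ hρ => iSup₂_le fun z0 hz0 => ?_
  set g := (pCyl d (3 * ρ) (max 0 (z0.1 - ρ ^ 2), z0.2) ∩ Q).indicator f with hg
  set a := ENNReal.ofReal (R ^ (-1 - β)) * U with ha
  set b := K * ENNReal.ofReal (ρ ^ (1 - β)) with hb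
  set v := cylV d ρ with hv
  set θ := v⁻¹ * volume (pCyl d ρ z0 ∩ Q) with hθ
  have v0 : v ≠ 0 := cylV_ne_zero d hρ
  have vt : v ≠ ∞ := cylV_ne_top d ρ
  have hbr : b ^ r = K ^ (r - q) * (ENNReal.ofReal (ρ ^ (-β)) * K) ^ q := by
    rw [hb, ENNReal.mul_rpow_of_nonneg _ _ hr0.le, ENNReal.mul_rpow_of_nonneg _ _ hq0.le,
      ENNReal.ofReal_rpow_of_nonneg (by positivity) hr0.le,
      ENNReal.ofReal_rpow_of_nonneg (by positivity) hq0.le, ← Real.rpow_mul hρ.le,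
      ← Real.rpow_mul hρ.le, mul_left_comm, ← ENNReal.rpow_add_of_nonneg _ _ hrq0 hq0.le, mul_comm]
    congr 3
    · linarith
    · ring
  have gm : Measurable g :=
    mf.indicator ((measurableSet_pCyl _ _ _).inter (measurableSet_pCyl _ _ _))
  have gb : ∀ z, g z ≤ ENNReal.ofReal cb := by
    intro z
    by_cases h : z ∈ pCyl d (3 * ρ) (max 0 (z0.1 - ρ ^ 2), z0.2) ∩ Q
    · rw [hg, indicator_of_mem h]; exact hcb' z h.2
    · rw [hg, indicator_of_notMem h]; simp
  have Mm := measurable_cMax d (2 * ρ) gm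
  have hM : ∫⁻ z, cMax d (2 * ρ) g z ^ q ≤ S * (ENNReal.ofReal (3 ^ (d + 2)) * v *
        (ENNReal.ofReal (ρ ^ (-β)) * K) ^ q) :=
    (cMax_strong d (by positivity) hq gm ENNReal.ofReal_ne_top gb).trans
      (mul_le_mul_right (int_g d hq hβ0 hρ (base1_mem d hR hz0)) _)
  have hpt : ∀ z ∈ pCyl d ρ z0 ∩ Q, ENNReal.ofReal (gradNorm d u z) ^ r ≤
      (3 * c) ^ r * (a ^ r + b ^ r + K ^ (r - q) * cMax d (2 * ρ) g z ^ q) := by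
    intro z hz
    refine (ENNReal.rpow_le_rpow (H' ρ hρ z0 z hz.1 hz.2) hr0.le).trans ?_
    rw [ENNReal.mul_rpow_of_nonneg _ _ hr0.le, mul_comm 3 c, ENNReal.mul_rpow_of_nonneg _ _ hr0.le,
      mul_assoc]
    refine mul_le_mul_right ((add3_rpow hr0 _ _ _).trans ?_) _
    rw [ENNReal.mul_rpow_of_nonneg (K ^ (1 / β)) _ hr0.le, ← ENNReal.rpow_mul, ← ENNReal.rpow_mul,
      ← hrq, ← hrq']
  have mQ : MeasurableSet Q := measurableSet_pCyl _ _ _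
  have havg : pAvg d ρ z0 (fun w => Q.indicator (fun z => ENNReal.ofReal (gradNorm d u z)) w ^ r) ≤
      (3 * c) ^ r * (a ^ r * θ + (1 + S3) * b ^ r) := by
    unfold pAvg
    rw [vol_pCyl d hρ]
    have e : (fun w => Q.indicator (fun z => ENNReal.ofReal (gradNorm d u z)) w ^ r) =
        Q.indicator (fun z => ENNReal.ofReal (gradNorm d u z) ^ r) := by
      ext w
      by_cases hw : w ∈ Q
      · simp [hw]
      · simp [hw, hr0]
    rw [e, setLIntegral_indicator mQ, inter_comm Q]
    have mI : MeasurableSet (pCyl d ρ z0 ∩ Q) := (measurableSet_pCyl _ _ _).inter mQ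
    calc v⁻¹ * ∫⁻ z in pCyl d ρ z0 ∩ Q, ENNReal.ofReal (gradNorm d u z) ^ r
        ≤ v⁻¹ * ∫⁻ z in pCyl d ρ z0 ∩ Q,
          (3 * c) ^ r * (a ^ r + b ^ r + K ^ (r - q) * cMax d (2 * ρ) g z ^ q) := by
            gcongr 1; exact setLIntegral_mono' mI hpt
      _ = v⁻¹ * ((3 * c) ^ r * ((a ^ r + b ^ r) * volume (pCyl d ρ z0 ∩ Q) +
            K ^ (r - q) * ∫⁻ z in pCyl d ρ z0 ∩ Q, cMax d (2 * ρ) g z ^ q)) := by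
          have m1 : Measurable fun z => cMax d (2 * ρ) g z ^ q := Mm.pow_const q
          have m2 : Measurable fun z => a ^ r + b ^ r + K ^ (r - q) * cMax d (2 * ρ) g z ^ q :=
            measurable_const.add (m1.const_mul _)
          rw [lintegral_const_mul _ m2,
            lintegral_add_left measurable_const, lintegral_const_mul _ m1]
          simp
      _ ≤ v⁻¹ * ((3 * c) ^ r * ((a ^ r * volume (pCyl d ρ z0 ∩ Q) + b ^ r * v) +
            K ^ (r - q) * (S * (ENNReal.ofReal (3 ^ (d + 2)) * v *
        (ENNReal.ofReal (ρ ^ (-β)) * K) ^ q)))) := by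
          rw [add_mul]
          gcongr
          · rw [hv, ← vol_pCyl d hρ z0]; exact measure_mono inter_subset_left
          · exact (setLIntegral_le_lintegral _ _).trans hM
      _ = (3 * c) ^ r * (a ^ r * θ + (v⁻¹ * v) * (b ^ r + S3 *
            (K ^ (r - q) * (ENNReal.ofReal (ρ ^ (-β)) * K) ^ q))) := by
          rw [hθ, hS3]; ring
      _ = _ := by
          rw [ENNReal.inv_mul_cancel v0 vt, ← hbr]; ring
  have h1 : (pAvg d ρ z0 (fun w => Q.indicator (fun z => ENNReal.ofReal (gradNorm d u z)) w ^ r)) ^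
      (1 / r) ≤ (3 * c) * (a * θ ^ (1 / r) + c2 * b) := by
    have k : ∀ x : ℝ≥0∞, (x ^ r) ^ (1 / r) = x := fun x => by
      rw [← ENNReal.rpow_mul, mul_one_div_cancel hr0.ne', ENNReal.rpow_one]
    refine (ENNReal.rpow_le_rpow havg hir).trans ?_
    rw [ENNReal.mul_rpow_of_nonneg _ _ hir, k]
    refine mul_le_mul_right ((ENNReal.rpow_add_le_add_rpow _ _ hir ?_).trans ?_) _
    · rw [div_le_one hr0]; exact hr1
    · rw [ENNReal.mul_rpow_of_nonneg (a ^ r) θ hir, ENNReal.mul_rpow_of_nonneg _ (b ^ r) hir, k, k]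
  have hθ' := theta_bound d hβ hr0 hrd hR hρ z0
  have hbK : ENNReal.ofReal (ρ ^ (β - 1)) * b = K := by
    rw [hb, mul_left_comm, ← ENNReal.ofReal_mul (by positivity), ← Real.rpow_add hρ]
    simp
  have haU : a * ENNReal.ofReal (R ^ (β - 1)) = ENNReal.ofReal (R ^ (-2 : ℝ)) * U := by
    rw [ha, mul_right_comm, ← ENNReal.ofReal_mul (by positivity), ← Real.rpow_add hR]
    congr 3
    ring
  calc _ ≤ ENNReal.ofReal (ρ ^ (β - 1)) * ((3 * c) * (a * θ ^ (1 / r) + c2 * b)) :=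
        mul_le_mul_right h1 _
    _ = (3 * c) * (a * (ENNReal.ofReal (ρ ^ (β - 1)) * θ ^ (1 / r)) +
          c2 * (ENNReal.ofReal (ρ ^ (β - 1)) * b)) := by ring
    _ ≤ (3 * c) * (a * ENNReal.ofReal (R ^ (β - 1)) + c2 * K) := by
        rw [hbK]
        gcongr
    _ = 3 * c * c2 * K + 3 * c * 1 * ENNReal.ofReal (R ^ (-2 : ℝ)) * U := by
        rw [haU]; ring
    _ ≤ _ := by
        gcongr
        · exact le_add_self
        · exact le_self_add

/-- Theorem 3.10: for `1 < q < d+2`, `β ∈ (1,(d+2)/q]`, `r(β−1) = qβ`,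
`‖Du‖_{E_{r,β−1}(C_R)} ≤ N ‖|∂_t u|+|D²u|‖_{E_{q,β}(C_R)} + N R^{-2} ‖u‖_{E_{q,β}(C_R)}`. -/
theorem stmt11 (d : ℕ) (hd : 1 ≤ d) (q β r : ℝ) (hq : 1 < q) (hq' : q < (d : ℝ) + 2)
    (hβ : 1 < β) (hβ' : β ≤ ((d : ℝ) + 2) / q) (hr : r * (β - 1) = q * β) :
    ∃ N : ℝ, 0 < N ∧ ∀ R : ℝ, 0 < R →
      ∀ u : Pt d → ℝ, ContDiff ℝ (⊤ : ℕ∞) u → HasCompactSupport u →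
        MorreyNorm d r (β - 1) (pCyl d R 0) (fun z => ENNReal.ofReal (gradNorm d u z)) ≤
          ENNReal.ofReal N * MorreyNorm d q β (pCyl d R 0)
              (fun z => ENNReal.ofReal (|timeDeriv d u z| + hessNorm d u z)) +
            ENNReal.ofReal (N * R ^ (-2 : ℝ)) * MorreyNorm d q β (pCyl d R 0)
              (fun z => ENNReal.ofReal |u z|) := by
  obtain ⟨N, hN, H⟩ := main_ennreal d q β r hq hβ hβ' hr
  have hle : N ≤ ENNReal.ofReal (N.toReal + 1) := by
    rw [← ENNReal.ofReal_toReal hN]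
    apply ENNReal.ofReal_le_ofReal
    rw [ENNReal.toReal_ofReal ENNReal.toReal_nonneg]; linarith
  have hpos : 0 < N.toReal + 1 := by positivity
  refine ⟨N.toReal + 1, hpos, fun R hR u hu _ => (H R hR u hu).trans ?_⟩
  rw [ENNReal.ofReal_mul hpos.le]
  gcongr

end
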